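/- Let u be real analytic on an open ball B centered at the origin of ℝ² satisfying J[Δu, det D²u] ≡ 0 on B. Assume that near the origin u has the form u(x,y) = (λ/2)(x²+y²) + w(x,y) + o(ρ^k), where ρ = √(x²+y²) and w is a homogeneous polynomial of degree k ≥ 3 that is neither harmonic nor a power of a linear function, i.e. w is not of the form a(αx+βy)^k with (α,β) ≠ (0,0). Then u is radial with respect to the origin: u(x,y) depends only on ρ. -/

import Mathlib

open Set Metric Topology Asymptotics MvPolynomial Matrix

/-- Partial derivative with respect to the first variable. -/
noncomputable def pdx (f : ℝ × ℝ → ℝ) (p : ℝ × ℝ) : ℝ :=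
  deriv (fun x => f (x, p.2)) p.1

/-- Partial derivative with respect to the second variable. -/
noncomputable def pdy (f : ℝ × ℝ → ℝ) (p : ℝ × ℝ) : ℝ :=
  deriv (fun y => f (p.1, y)) p.2

/-- The Laplacian `Δu = u_xx + u_yy`. -/
noncomputable def lap (f : ℝ × ℝ → ℝ) (p : ℝ × ℝ) : ℝ :=
  pdx (pdx f) p + pdy (pdy f) p

/-- The Hessian determinant `det D²u = u_xx u_yy - u_xy²`. -/
noncomputable def hessDet (f : ℝ × ℝ → ℝ) (p : ℝ × ℝ) : ℝ :=
  pdx (pdx f) p * pdy (pdy f) p - (pdx (pdy f) p) ^ 2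

/-- The Jacobian `J[f,g] = f_x g_y - f_y g_x`. -/
noncomputable def jacDet (f g : ℝ × ℝ → ℝ) (p : ℝ × ℝ) : ℝ :=
  pdx f p * pdy g p - pdy f p * pdx g p

open scoped ComplexConjugate

/-- The Wirtinger derivative `∂/∂z = (∂/∂x - i ∂/∂y) / 2` on complex functions of `(x, y)`. -/
noncomputable def wirtZ (f : ℝ × ℝ → ℂ) (p : ℝ × ℝ) : ℂ :=
  (fderiv ℝ f p (1, 0) - Complex.I * fderiv ℝ f p (0, 1)) / 2

/-- The Wirtinger derivative `∂/∂z̄ = (∂/∂x + i ∂/∂y) / 2` on complex functions of `(x, y)`. -/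
noncomputable def wirtW (f : ℝ × ℝ → ℂ) (p : ℝ × ℝ) : ℂ :=
  (fderiv ℝ f p (1, 0) + Complex.I * fderiv ℝ f p (0, 1)) / 2

/-- The degree `n` homogeneous part `∑ aᵢ zⁱ z̄ⁿ⁻ⁱ` of the Taylor expansion of `f` at the origin,
dehomogenized to the one-variable polynomial `∑ aᵢ tⁱ`. -/
noncomputable def jet : ℕ → (ℝ × ℝ → ℂ) → Polynomial ℂ
  | 0, f => Polynomial.C (f 0)
  | n + 1, f => Polynomial.C ((n + 1 : ℂ)⁻¹) * (Polynomial.X * jet n (wirtZ f) + jet n (wirtW f))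

section Wirtinger

variable {f g : ℝ × ℝ → ℂ} {p : ℝ × ℝ}

lemma analyticAt_fderiv_apply (hf : AnalyticAt ℝ f p) (v : ℝ × ℝ) :
    AnalyticAt ℝ (fun q => fderiv ℝ f q v) p :=
  ((ContinuousLinearMap.apply ℝ ℂ v).analyticAt _).comp hf.fderiv

lemma AnalyticAt.wirtZ (hf : AnalyticAt ℝ f p) : AnalyticAt ℝ (wirtZ f) p :=
  ((analyticAt_fderiv_apply hf _).sub
    (analyticAt_const.mul (analyticAt_fderiv_apply hf _))).div_const

lemma AnalyticAt.wirtW (hf : AnalyticAt ℝ f p) : AnalyticAt ℝ (wirtW f) p :=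
  ((analyticAt_fderiv_apply hf _).add
    (analyticAt_const.mul (analyticAt_fderiv_apply hf _))).div_const

lemma wirtZ_congr (h : f =ᶠ[𝓝 p] g) : wirtZ f =ᶠ[𝓝 p] wirtZ g := by
  filter_upwards [h.fderiv (𝕜 := ℝ)] with q hq
  simp only [wirtZ, hq]

lemma wirtW_congr (h : f =ᶠ[𝓝 p] g) : wirtW f =ᶠ[𝓝 p] wirtW g := by
  filter_upwards [h.fderiv (𝕜 := ℝ)] with q hq
  simp only [wirtW, hq]

lemma wirtZ_add (hf : AnalyticAt ℝ f p) (hg : AnalyticAt ℝ g p) :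
    wirtZ (f + g) =ᶠ[𝓝 p] wirtZ f + wirtZ g := by
  filter_upwards [hf.eventually_analyticAt, hg.eventually_analyticAt] with q hf hg
  simp only [wirtZ, fderiv_add hf.differentiableAt hg.differentiableAt, Pi.add_apply,
    _root_.add_apply]
  ring

lemma wirtW_add (hf : AnalyticAt ℝ f p) (hg : AnalyticAt ℝ g p) :
    wirtW (f + g) =ᶠ[𝓝 p] wirtW f + wirtW g := by
  filter_upwards [hf.eventually_analyticAt, hg.eventually_analyticAt] with q hf hg
  simp only [wirtW, fderiv_add hf.differentiableAt hg.differentiableAt, Pi.add_apply,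
    _root_.add_apply]
  ring

lemma wirtZ_mul (hf : AnalyticAt ℝ f p) (hg : AnalyticAt ℝ g p) :
    wirtZ (f * g) =ᶠ[𝓝 p] wirtZ f * g + f * wirtZ g := by
  filter_upwards [hf.eventually_analyticAt, hg.eventually_analyticAt] with q hf hg
  simp only [wirtZ, fderiv_mul hf.differentiableAt hg.differentiableAt, Pi.add_apply, Pi.mul_apply,
    _root_.add_apply, _root_.smul_apply, smul_eq_mul]
  ring

lemma wirtW_mul (hf : AnalyticAt ℝ f p) (hg : AnalyticAt ℝ g p) :
    wirtW (f * g) =ᶠ[𝓝 p] wirtW f * g + f * wirtW g := by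
  filter_upwards [hf.eventually_analyticAt, hg.eventually_analyticAt] with q hf hg
  simp only [wirtW, fderiv_mul hf.differentiableAt hg.differentiableAt, Pi.add_apply, Pi.mul_apply,
    _root_.add_apply, _root_.smul_apply, smul_eq_mul]
  ring

lemma fderiv_wirtZ (hf : AnalyticAt ℝ f p) (v : ℝ × ℝ) :
    fderiv ℝ (wirtZ f) p v = (fderiv ℝ (fderiv ℝ f) p v (1, 0)
      - Complex.I * fderiv ℝ (fderiv ℝ f) p v (0, 1)) / 2 := by
  have hd := hf.fderiv.differentiableAt.hasFDerivAt
  have h1 := hd.clm_apply (hasFDerivAt_const ((1 : ℝ), (0 : ℝ)) p)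
  have h2 := hd.clm_apply (hasFDerivAt_const ((0 : ℝ), (1 : ℝ)) p)
  have h3 := ((h1.sub (h2.const_mul Complex.I)).mul_const ((2 : ℂ)⁻¹))
  have h4 : HasFDerivAt (wirtZ f) _ p := h3.congr_of_eventuallyEq
    (Filter.Eventually.of_forall fun q => by simp [wirtZ, div_eq_mul_inv])
  rw [h4.fderiv]
  simp
  ring

lemma fderiv_wirtW (hf : AnalyticAt ℝ f p) (v : ℝ × ℝ) :
    fderiv ℝ (wirtW f) p v = (fderiv ℝ (fderiv ℝ f) p v (1, 0)
      + Complex.I * fderiv ℝ (fderiv ℝ f) p v (0, 1)) / 2 := by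
  have hd := hf.fderiv.differentiableAt.hasFDerivAt
  have h1 := hd.clm_apply (hasFDerivAt_const ((1 : ℝ), (0 : ℝ)) p)
  have h2 := hd.clm_apply (hasFDerivAt_const ((0 : ℝ), (1 : ℝ)) p)
  have h3 := ((h1.add (h2.const_mul Complex.I)).mul_const ((2 : ℂ)⁻¹))
  have h4 : HasFDerivAt (wirtW f) _ p := h3.congr_of_eventuallyEq
    (Filter.Eventually.of_forall fun q => by simp [wirtW, div_eq_mul_inv])
  rw [h4.fderiv]
  simp
  ring

lemma wirt_comm (hf : AnalyticAt ℝ f p) :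
    wirtW (wirtZ f) =ᶠ[𝓝 p] wirtZ (wirtW f) := by
  filter_upwards [hf.eventually_analyticAt] with q hf
  have hs : fderiv ℝ (fderiv ℝ f) q (1, 0) (0, 1) = fderiv ℝ (fderiv ℝ f) q (0, 1) (1, 0) :=
    (hf.contDiffAt (n := 2)).isSymmSndFDerivAt (by simp) |>.eq _ _
  rw [wirtW, wirtZ]
  simp only [fderiv_wirtZ hf, fderiv_wirtW hf, hs]
  ring

end Wirtinger

section Jet

variable {f g : ℝ × ℝ → ℂ}

lemma jet_congr (n : ℕ) : ∀ {f g : ℝ × ℝ → ℂ}, f =ᶠ[𝓝 0] g → jet n f = jet n g := by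
  induction n with
  | zero => intro f g h; simp only [jet, h.eq_of_nhds]
  | succ n ih => intro f g h; simp only [jet, ih (wirtZ_congr h), ih (wirtW_congr h)]

lemma jet_add (n : ℕ) : ∀ {f g : ℝ × ℝ → ℂ}, AnalyticAt ℝ f 0 → AnalyticAt ℝ g 0 →
    jet n (f + g) = jet n f + jet n g := by
  induction n with
  | zero => intro f g _ _; simp [jet]
  | succ n ih =>
    intro f g hf hg
    simp only [jet, jet_congr n (wirtZ_add hf hg), jet_congr n (wirtW_add hf hg),
      ih hf.wirtZ hg.wirtZ, ih hf.wirtW hg.wirtW]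
    ring

lemma succ_mul_jet (n : ℕ) (f : ℝ × ℝ → ℂ) :
    ((n : Polynomial ℂ) + 1) * jet (n + 1) f
      = Polynomial.X * jet n (wirtZ f) + jet n (wirtW f) := by
  have h : ((n : Polynomial ℂ) + 1) = Polynomial.C (n + 1 : ℂ) := by simp
  have h0 : (n + 1 : ℂ) ≠ 0 := Nat.cast_add_one_ne_zero n
  rw [jet, h, ← mul_assoc, ← Polynomial.C_mul, mul_inv_cancel₀ h0, Polynomial.C_1, one_mul]

lemma derivative_powerSeries_mul {A : Type*} [CommRing A] (F G : PowerSeries A) :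
    PowerSeries.derivative A (F * G)
      = F * PowerSeries.derivative A G + G * PowerSeries.derivative A F := by
  simp [Derivation.leibniz]

lemma jet_mul (n : ℕ) : ∀ {f g : ℝ × ℝ → ℂ}, AnalyticAt ℝ f 0 → AnalyticAt ℝ g 0 →
    jet n (f * g) = ∑ ij ∈ Finset.HasAntidiagonal.antidiagonal n, jet ij.1 f * jet ij.2 g := by
  have key : ∀ f g : ℝ × ℝ → ℂ, ∑ ij ∈ Finset.HasAntidiagonal.antidiagonal n, jet ij.1 f * jet ij.2 g
      = PowerSeries.coeff n (PowerSeries.mk (jet · f) * PowerSeries.mk (jet · g)) := by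
    intro f g; simp [PowerSeries.coeff_mul]
  have hd : ∀ f : ℝ × ℝ → ℂ, PowerSeries.derivative (Polynomial ℂ) (PowerSeries.mk (jet · f))
      = PowerSeries.C Polynomial.X * PowerSeries.mk (jet · (wirtZ f))
        + PowerSeries.mk (jet · (wirtW f)) := by
    intro f
    ext1 m
    rw [PowerSeries.coeff_derivative]
    simp only [PowerSeries.coeff_mk, map_add, PowerSeries.coeff_C_mul]
    rw [← succ_mul_jet, mul_comm]
  simp only [key]
  clear key
  induction n with
  | zero => intro f g _ _; simp [jet]
  | succ n ih =>
    intro f g hf hg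
    have h0 : ((n : Polynomial ℂ) + 1) ≠ 0 := Nat.cast_add_one_ne_zero n
    apply mul_left_cancel₀ h0
    rw [succ_mul_jet, mul_comm _ (PowerSeries.coeff _ _), ← PowerSeries.coeff_derivative,
      derivative_powerSeries_mul, hd, hd, jet_congr n (wirtZ_mul hf hg), jet_congr n (wirtW_mul hf hg),
      jet_add n (hf.wirtZ.mul hg) (hf.mul hg.wirtZ), jet_add n (hf.wirtW.mul hg) (hf.mul hg.wirtW),
      ih hf.wirtZ hg, ih hf hg.wirtZ, ih hf.wirtW hg, ih hf hg.wirtW]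
    simp only [mul_add, map_add, mul_left_comm _ (PowerSeries.C _) _,
      PowerSeries.coeff_C_mul]
    rw [mul_comm (PowerSeries.mk (jet · g)), mul_comm (PowerSeries.mk (jet · g))]
    ring

lemma derivative_jet (n : ℕ) : ∀ {f : ℝ × ℝ → ℂ}, AnalyticAt ℝ f 0 →
    Polynomial.derivative (jet (n + 1) f) = jet n (wirtZ f) := by
  induction n with
  | zero => intro f _; simp [jet]
  | succ n ih =>
    intro f hf
    have h0 : (((n + 1 : ℕ) : Polynomial ℂ) + 1) ≠ 0 := Nat.cast_add_one_ne_zero _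
    apply mul_left_cancel₀ h0
    have h1 := congrArg Polynomial.derivative (succ_mul_jet (n + 1) f)
    have h2 := succ_mul_jet n (wirtZ f)
    simp only [Polynomial.derivative_mul, Polynomial.derivative_add, Polynomial.derivative_X,
      Polynomial.derivative_natCast, Polynomial.derivative_one, ih hf.wirtZ, ih hf.wirtW] at h1
    rw [← jet_congr n (wirt_comm hf)] at h1
    push_cast at h1 ⊢
    linear_combination h1 - h2

lemma jet_wirtW (n : ℕ) {f : ℝ × ℝ → ℂ} (hf : AnalyticAt ℝ f 0) :
    jet n (wirtW f) = ((n : Polynomial ℂ) + 1) * jet (n + 1) f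
      - Polynomial.X * Polynomial.derivative (jet (n + 1) f) := by
  rw [derivative_jet n hf, succ_mul_jet]; ring

lemma natDegree_jet_le (n : ℕ) : ∀ f : ℝ × ℝ → ℂ, (jet n f).natDegree ≤ n := by
  induction n with
  | zero => intro f; simp [jet]
  | succ n ih =>
    intro f
    refine (Polynomial.natDegree_C_mul_le _ _).trans (Polynomial.natDegree_add_le_of_degree_le ?_ ?_)
    · rw [add_comm]
      exact Polynomial.natDegree_mul_le_of_le Polynomial.natDegree_X_le (ih _)
    · exact (ih _).trans n.le_succ

lemma wirt_conj (hf : AnalyticAt ℝ f 0) :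
    (wirtZ (fun q => conj (f q)) =ᶠ[𝓝 0] fun q => conj (wirtW f q)) ∧
    (wirtW (fun q => conj (f q)) =ᶠ[𝓝 0] fun q => conj (wirtZ f q)) := by
  have h : ∀ᶠ q in 𝓝 (0 : ℝ × ℝ), ∀ v, fderiv ℝ (fun q => conj (f q)) q v
      = conj (fderiv ℝ f q v) := by
    filter_upwards [hf.eventually_analyticAt] with q hf v
    have := (Complex.conjCLE.toContinuousLinearMap.hasFDerivAt (x := f q)).comp q
      hf.differentiableAt.hasFDerivAt
    have h2 : HasFDerivAt (fun q => conj (f q)) _ q := this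
    rw [h2.fderiv]; simp
  constructor <;> filter_upwards [h] with q hq <;>
    simp [wirtZ, wirtW, hq, Complex.conj_ofNat, sub_eq_add_neg]

lemma coeff_jet_conj (n : ℕ) : ∀ {f : ℝ × ℝ → ℂ}, AnalyticAt ℝ f 0 → ∀ i j, i + j = n →
    (jet n (fun q => conj (f q))).coeff i = conj ((jet n f).coeff j) := by
  induction n with
  | zero =>
    intro f _ i j hij
    obtain ⟨rfl, rfl⟩ : i = 0 ∧ j = 0 := by omega
    simp [jet]
  | succ n ih =>
    intro f hf i j hij
    have h1 : ∀ (m : ℕ) (a : Polynomial ℂ), (Polynomial.X * a).coeff m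
        = if m = 0 then 0 else a.coeff (m - 1) := by
      intro m a; cases m <;> simp
    have hz : ∀ (g : ℝ × ℝ → ℂ), (jet n g).coeff (n + 1) = 0 := fun g =>
      Polynomial.coeff_eq_zero_of_natDegree_lt (Nat.lt_succ_of_le (natDegree_jet_le n g))
    simp only [jet, jet_congr n (wirt_conj hf).1, jet_congr n (wirt_conj hf).2,
      Polynomial.coeff_C_mul, Polynomial.coeff_add, h1, map_mul, map_add]
    congr 1
    · simp
    rw [add_comm (conj _)]
    congr 1
    · split_ifs with hi
      · obtain rfl : j = n + 1 := by omega
        simp [hz]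
      · exact ih hf.wirtW _ _ (by omega)
    · split_ifs with hj
      · obtain rfl : i = n + 1 := by omega
        simp [hz]
      · exact ih hf.wirtZ _ _ (by omega)

end Jet

section Line

/-- The point `(x, y)` as the complex number `x + i y`. -/
def toComplex (p : ℝ × ℝ) : ℂ := ⟨p.1, p.2⟩

lemma toComplex_ne_zero {p : ℝ × ℝ} (hp : p ≠ 0) : toComplex p ≠ 0 := by
  intro h
  apply hp
  have h1 := congrArg Complex.re h
  have h2 := congrArg Complex.im h
  exact Prod.ext h1 h2

lemma analyticAt_line {f : ℝ × ℝ → ℂ} {p : ℝ × ℝ} {s : ℝ} (hf : AnalyticAt ℝ f (s • p)) :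
    AnalyticAt ℝ (fun s : ℝ => f (s • p)) s :=
  AnalyticAt.fun_comp (g := f) (f := fun s : ℝ => s • p) hf (by fun_prop)

lemma deriv_line {f : ℝ × ℝ → ℂ} (hf : AnalyticAt ℝ f 0) (p : ℝ × ℝ) :
    deriv (fun s : ℝ => f (s • p)) =ᶠ[𝓝 0] (fun s : ℝ => toComplex p * wirtZ f (s • p))
      + fun s : ℝ => conj (toComplex p) * wirtW f (s • p) := by
  have hc : Filter.Tendsto (fun s : ℝ => s • p) (𝓝 0) (𝓝 0) := by
    have : Continuous fun s : ℝ => s • p := by fun_prop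
    simpa using this.tendsto 0
  filter_upwards [hc.eventually hf.eventually_analyticAt] with s hs
  have h1 : HasDerivAt (fun s : ℝ => s • p) p s := by
    simpa using (hasDerivAt_id s).smul_const p
  have h2 := hs.differentiableAt.hasFDerivAt.comp_hasDerivAt s h1
  have h3 : fderiv ℝ f (s • p) p
      = p.1 * fderiv ℝ f (s • p) (1, 0) + p.2 * fderiv ℝ f (s • p) (0, 1) := by
    have : p = p.1 • ((1 : ℝ), (0 : ℝ)) + p.2 • ((0 : ℝ), (1 : ℝ)) := by ext <;> simp
    conv_lhs => arg 2; rw [this]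
    rw [map_add, map_smul, map_smul]
    simp
  have h4 : toComplex p = p.1 + p.2 * Complex.I := by
    apply Complex.ext <;> simp [toComplex]
  have h5 : deriv (fun s : ℝ => f (s • p)) s = fderiv ℝ f (s • p) p := h2.deriv
  rw [h5, h3]
  simp only [Pi.add_apply, wirtZ, wirtW, h4, map_add, map_mul, Complex.conj_ofReal, Complex.conj_I]
  linear_combination (p.2 * fderiv ℝ f (s • p) (0, 1)) * Complex.I_mul_I

/-- The iterated derivatives of `f` along a line through the origin in terms of its jets. -/
lemma iteratedDeriv_line (n : ℕ) : ∀ {f : ℝ × ℝ → ℂ}, AnalyticAt ℝ f 0 → ∀ {p : ℝ × ℝ}, p ≠ 0 →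
    iteratedDeriv n (fun s : ℝ => f (s • p)) 0 = n.factorial * conj (toComplex p) ^ n
      * (jet n f).eval (toComplex p / conj (toComplex p)) := by
  induction n with
  | zero => intro f _ p _; simp [jet]
  | succ n ih =>
    intro f hf p hp
    have hz : conj (toComplex p) ≠ 0 := by simpa using toComplex_ne_zero hp
    have hana : ∀ {g : ℝ × ℝ → ℂ}, AnalyticAt ℝ g 0 →
        ContDiffAt ℝ n (fun s : ℝ => g (s • p)) 0 :=
      fun hg => (analyticAt_line (by simpa using hg)).contDiffAt
    rw [iteratedDeriv_succ', (deriv_line hf p).iteratedDeriv_eq,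
      iteratedDeriv_add (contDiffAt_const.mul (hana hf.wirtZ))
        (contDiffAt_const.mul (hana hf.wirtW)),
      iteratedDeriv_const_mul _ (hana hf.wirtZ), iteratedDeriv_const_mul _ (hana hf.wirtW),
      ih hf.wirtZ hp, ih hf.wirtW hp]
    have h1 := congrArg (Polynomial.eval (toComplex p / conj (toComplex p))) (succ_mul_jet n f)
    simp only [Polynomial.eval_mul, Polynomial.eval_add, Polynomial.eval_natCast,
      Polynomial.eval_one, Polynomial.eval_X] at h1
    rw [Nat.factorial_succ]
    push_cast
    have h2 : toComplex p = conj (toComplex p) * (toComplex p / conj (toComplex p)) := by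
      field_simp
    generalize toComplex p / conj (toComplex p) = t at *
    generalize conj (toComplex p) = w at *
    rw [h2]
    linear_combination (-(n.factorial : ℂ) * w ^ (n + 1)) * h1

lemma eq_zero_of_forall_eval_eq_zero {P : Polynomial ℂ}
    (h : ∀ p : ℝ × ℝ, p ≠ 0 → P.eval (toComplex p / conj (toComplex p)) = 0) : P = 0 := by
  apply Polynomial.eq_zero_of_infinite_isRoot
  refine Set.infinite_of_injective_forall_mem
    (f := fun s : ℝ => toComplex (1, s) / conj (toComplex (1, s))) ?_ ?_
  · intro s t hst
    have h0 : ∀ r : ℝ, conj (toComplex (1, r)) ≠ 0 := fun r => by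
      simpa using toComplex_ne_zero (p := (1, r)) (by simp)
    have h1 := (div_eq_div_iff (h0 s) (h0 t)).1 hst
    have h2 := congrArg Complex.im h1
    simp [toComplex] at h2
    linarith
  · intro s
    exact h (1, s) (by simp)

lemma jet_eq_zero_of_iteratedDeriv_line {n : ℕ} {f : ℝ × ℝ → ℂ} (hf : AnalyticAt ℝ f 0)
    (h : ∀ p : ℝ × ℝ, p ≠ 0 → iteratedDeriv n (fun s : ℝ => f (s • p)) 0 = 0) : jet n f = 0 := by
  apply eq_zero_of_forall_eval_eq_zero
  intro p hp
  have h1 := h p hp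
  rw [iteratedDeriv_line n hf hp] at h1
  have hz : conj (toComplex p) ≠ 0 := by simpa using toComplex_ne_zero hp
  simpa [Nat.factorial_ne_zero, hz] using h1

lemma iteratedDeriv_eq_zero_of_isLittleO {h : ℝ → ℂ} (hh : AnalyticAt ℝ h 0) {k : ℕ}
    (ho : h =o[𝓝 0] fun s : ℝ => s ^ k) {n : ℕ} (hn : n ≤ k) : iteratedDeriv n h 0 = 0 := by
  refine (natCast_le_analyticOrderAt_iff_iteratedDeriv_eq_zero hh (n := k + 1)).1 ?_ n
    (Nat.lt_succ_of_le hn)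
  by_contra hlt
  rw [not_le] at hlt
  obtain ⟨m, hm⟩ := ENat.ne_top_iff_exists.1 hlt.ne_top
  rw [← hm] at hlt
  have hmk : m ≤ k := Nat.lt_succ_iff.1 (by exact_mod_cast hlt)
  obtain ⟨g, hg, hg0, hgh⟩ := hh.analyticOrderAt_eq_natCast.1 hm.symm
  have hinv : (fun s => (g s)⁻¹) =O[𝓝 0] fun _ => (1 : ℝ) :=
    (hg.continuousAt.inv₀ hg0).isBigO_one ℝ
  have hne : ∀ᶠ s in 𝓝 (0 : ℝ), g s ≠ 0 := hg.continuousAt.eventually_ne hg0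
  have h1 : (fun s : ℝ => ((s ^ m : ℝ) : ℂ)) =o[𝓝 0] fun s : ℝ => s ^ k := by
    have := hinv.mul_isLittleO ho
    refine this.congr' ?_ (by simp)
    filter_upwards [hgh, hne] with s hs hs0
    rw [hs]
    simp
    field_simp
  have h2 : (fun s : ℝ => s ^ k) =O[𝓝 0] fun s : ℝ => ((s ^ m : ℝ) : ℂ) := by
    refine IsBigO.of_bound 1 ?_
    filter_upwards [Metric.ball_mem_nhds (0 : ℝ) one_pos] with s hs
    rw [mem_ball_zero_iff] at hs
    rw [Complex.norm_real, norm_pow, norm_pow, one_mul]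
    exact pow_le_pow_of_le_one (norm_nonneg s) hs.le hmk
  refine isLittleO_irrefl ?_ (h1.trans_isBigO h2)
  refine Filter.Frequently.filter_mono ?_ (nhdsWithin_le_nhds (s := {0}ᶜ))
  refine (eventually_mem_nhdsWithin.mono fun s hs => ?_).frequently
  exact_mod_cast pow_ne_zero m hs

lemma eqOn_zero_of_iteratedDeriv_eq_zero {h : ℝ → ℂ} {S : Set ℝ} (hS : IsPreconnected S)
    (h0 : (0 : ℝ) ∈ S) (hh : AnalyticOnNhd ℝ h S) (hd : ∀ n, iteratedDeriv n h 0 = 0) :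
    EqOn h 0 S := by
  refine hh.eqOn_zero_of_preconnected_of_eventuallyEq_zero hS h0 ?_
  rw [Filter.EventuallyEq]
  simp only [Pi.zero_apply]
  rw [← analyticOrderAt_eq_top]
  refine ENat.eq_top_iff_forall_ge.2 fun n => ?_
  exact (natCast_le_analyticOrderAt_iff_iteratedDeriv_eq_zero (hh 0 h0)).2 fun i _ => hd i

lemma iteratedDeriv_pow_smul (n k : ℕ) (c : ℂ) :
    iteratedDeriv n (fun s : ℝ => s ^ k • c) 0 = if n = k then (k.factorial : ℂ) * c else 0 := by
  rw [iteratedDeriv_smul_const (by fun_prop), iteratedDeriv_pow]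
  split_ifs with h
  · subst h
    simp [Nat.descFactorial_self]
  · rcases lt_or_gt_of_ne h with h | h
    · simp [zero_pow (Nat.sub_ne_zero_of_lt h)]
    · simp [Nat.descFactorial_eq_zero_iff_lt.2 h]

lemma jet_of_homogeneous {f : ℝ × ℝ → ℂ} (hf : AnalyticAt ℝ f 0) {k n : ℕ}
    (hh : ∀ (s : ℝ) (p : ℝ × ℝ), f (s • p) = s ^ k • f p) (hn : n ≠ k) : jet n f = 0 :=
  jet_eq_zero_of_iteratedDeriv_line hf fun p _ => by
    simp only [hh, iteratedDeriv_pow_smul, if_neg hn]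

lemma eval_jet_of_homogeneous {f : ℝ × ℝ → ℂ} (hf : AnalyticAt ℝ f 0) {k : ℕ}
    (hh : ∀ (s : ℝ) (p : ℝ × ℝ), f (s • p) = s ^ k • f p) {p : ℝ × ℝ} (hp : p ≠ 0) :
    f p = conj (toComplex p) ^ k * (jet k f).eval (toComplex p / conj (toComplex p)) := by
  have h1 := iteratedDeriv_line k hf hp
  simp only [hh, iteratedDeriv_pow_smul, if_true, mul_assoc] at h1
  exact mul_left_cancel₀ (by exact_mod_cast k.factorial_ne_zero) h1

end Line

section HomogeneousOperators

/-- The dehomogenized operator `∂²/∂z²`. -/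
noncomputable def opZZ (f : Polynomial ℂ) : Polynomial ℂ :=
  Polynomial.derivative (Polynomial.derivative f)

/-- The dehomogenized operator `∂²/∂z∂z̄` on forms of degree `n`. -/
noncomputable def opZW (n : ℕ) (f : Polynomial ℂ) : Polynomial ℂ :=
  ((n : Polynomial ℂ) - 1) * Polynomial.derivative f
    - Polynomial.X * Polynomial.derivative (Polynomial.derivative f)

/-- The dehomogenized operator `∂²/∂z̄²` on forms of degree `n`. -/
noncomputable def opWW (n : ℕ) (f : Polynomial ℂ) : Polynomial ℂ :=
  (n : Polynomial ℂ) * ((n : Polynomial ℂ) - 1) * f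
    - 2 * ((n : Polynomial ℂ) - 1) * (Polynomial.X * Polynomial.derivative f)
    + Polynomial.X ^ 2 * Polynomial.derivative (Polynomial.derivative f)

variable {f g : Polynomial ℂ} {k : ℕ} {c : ℂ}

lemma coeff_X_mul_derivative (f : Polynomial ℂ) (i : ℕ) :
    (Polynomial.X * Polynomial.derivative f).coeff i = i * f.coeff i := by
  cases i with
  | zero => simp
  | succ i => simp [Polynomial.coeff_derivative]; ring

lemma coeff_X_sq_mul_opZZ (f : Polynomial ℂ) (i : ℕ) :
    (Polynomial.X ^ 2 * opZZ f).coeff i = i * (i - 1) * f.coeff i := by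
  have h : Polynomial.X ^ 2 * opZZ f = Polynomial.X * Polynomial.derivative
      (Polynomial.X * Polynomial.derivative f) - Polynomial.X * Polynomial.derivative f := by
    simp [opZZ]; ring
  simp only [h, Polynomial.coeff_sub, coeff_X_mul_derivative]
  ring

lemma coeff_natCast_mul' (n : ℕ) (f : Polynomial ℂ) (i : ℕ) :
    ((n : Polynomial ℂ) * f).coeff i = n * f.coeff i :=
  Polynomial.coeff_natCast_mul

lemma coeff_X_mul_opZW (n : ℕ) (f : Polynomial ℂ) (i : ℕ) :
    (Polynomial.X * opZW n f).coeff i = i * (n - i) * f.coeff i := by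
  have h : Polynomial.X * opZW n f = (n : Polynomial ℂ) * (Polynomial.X * Polynomial.derivative f)
      - Polynomial.X * Polynomial.derivative f - Polynomial.X ^ 2 * opZZ f := by
    simp [opZW, opZZ]; ring
  simp only [h, Polynomial.coeff_sub, coeff_natCast_mul', coeff_X_mul_derivative,
    coeff_X_sq_mul_opZZ]
  ring

lemma coeff_opWW (n : ℕ) (f : Polynomial ℂ) (i : ℕ) :
    (opWW n f).coeff i = (n - i) * (n - i - 1) * f.coeff i := by
  have h : opWW n f = (n : Polynomial ℂ) * ((n : Polynomial ℂ) * f) - (n : Polynomial ℂ) * f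
      - (n : Polynomial ℂ) * (Polynomial.X * Polynomial.derivative f)
      - (n : Polynomial ℂ) * (Polynomial.X * Polynomial.derivative f)
      + Polynomial.X * Polynomial.derivative f + Polynomial.X * Polynomial.derivative f
      + Polynomial.X ^ 2 * opZZ f := by
    simp [opWW, opZZ]; ring
  simp only [h, Polynomial.coeff_sub, Polynomial.coeff_add, coeff_natCast_mul',
    coeff_X_mul_derivative, coeff_X_sq_mul_opZZ]
  ring

/-- If `E` and `H²` have proportional logarithmic derivatives, they are proportional. -/
lemma exists_eq_C_mul_sq {H E : Polynomial ℂ} (hH : H ≠ 0)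
    (h : 2 * Polynomial.derivative H * E = H * Polynomial.derivative E) :
    ∃ c : ℂ, E = Polynomial.C c * H ^ 2 := by
  have key : ∀ F : Polynomial ℂ, F ≠ 0 →
      2 * Polynomial.derivative H * F = H * Polynomial.derivative F →
      F.natDegree = 2 * H.natDegree := by
    intro F hF hFH
    have h1 := congrArg (Polynomial.coeff · (H.natDegree + F.natDegree))
      (show 2 * (Polynomial.X * Polynomial.derivative H) * F
        = H * (Polynomial.X * Polynomial.derivative F) by linear_combination Polynomial.X * hFH)
    have hle : ∀ P : Polynomial ℂ, (Polynomial.X * Polynomial.derivative P).natDegree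
        ≤ P.natDegree := fun P => Polynomial.natDegree_le_iff_coeff_eq_zero.2 fun N hN => by
      rw [coeff_X_mul_derivative, Polynomial.coeff_eq_zero_of_natDegree_lt hN, mul_zero]
    have h2 : (2 * (Polynomial.X * Polynomial.derivative H)).natDegree ≤ H.natDegree := by
      refine Polynomial.natDegree_le_iff_coeff_eq_zero.2 fun N hN => ?_
      rw [show (2 : Polynomial ℂ) = ((2 : ℕ) : Polynomial ℂ) by norm_num, coeff_natCast_mul',
        Polynomial.coeff_eq_zero_of_natDegree_lt ((hle H).trans_lt hN), mul_zero]
    simp only [Polynomial.coeff_mul_add_eq_of_natDegree_le h2 le_rfl,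
      Polynomial.coeff_mul_add_eq_of_natDegree_le le_rfl (hle F)] at h1
    rw [show (2 : Polynomial ℂ) = ((2 : ℕ) : Polynomial ℂ) by norm_num, coeff_natCast_mul',
      coeff_X_mul_derivative, coeff_X_mul_derivative] at h1
    have hH' : H.coeff H.natDegree ≠ 0 := by simpa using hH
    have hF' : F.coeff F.natDegree ≠ 0 := by simpa using hF
    have h3 : ((2 * H.natDegree : ℕ) : ℂ) = F.natDegree := by
      apply mul_right_cancel₀ (mul_ne_zero hH' hF')
      push_cast
      push_cast at h1
      linear_combination h1
    exact_mod_cast h3.symm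
  by_cases hE : E = 0
  · exact ⟨0, by simp [hE]⟩
  have hEd := key E hE h
  refine ⟨E.leadingCoeff / H.leadingCoeff ^ 2, ?_⟩
  by_contra hne
  set c := E.leadingCoeff / H.leadingCoeff ^ 2
  have hF : E - Polynomial.C c * H ^ 2 ≠ 0 := sub_ne_zero.2 hne
  have hFd := key _ hF (by
    simp only [Polynomial.derivative_sub, Polynomial.derivative_mul, Polynomial.derivative_pow,
      Polynomial.derivative_C]
    simp [map_ofNat]
    linear_combination h)
  have hlead : (E - Polynomial.C c * H ^ 2).coeff (2 * H.natDegree) = 0 := by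
    rw [Polynomial.coeff_sub, Polynomial.coeff_C_mul, ← hEd, ← Polynomial.leadingCoeff, hEd,
      Polynomial.coeff_pow_mul_natDegree]
    have : H.leadingCoeff ≠ 0 := by simpa using hH
    simp only [c]
    field_simp
    ring
  rw [← hFd] at hlead
  exact hF (by simpa using hlead)

/-! ### Local analysis at a root -/

lemma derivative_root_pow_mul (t : ℂ) (M : ℕ) (e : Polynomial ℂ) :
    (Polynomial.X - Polynomial.C t) * Polynomial.derivative ((Polynomial.X - Polynomial.C t) ^ M * e)
      = (Polynomial.X - Polynomial.C t) ^ M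
        * ((M : Polynomial ℂ) * e + (Polynomial.X - Polynomial.C t) * Polynomial.derivative e) := by
  cases M with
  | zero => simp
  | succ M => simp [Polynomial.derivative_pow]; ring

lemma exists_root_expansion (t : ℂ) (M : ℕ) (e : Polynomial ℂ)
    (hf : f = (Polynomial.X - Polynomial.C t) ^ M * e) :
    ∃ e₁ e₂ : Polynomial ℂ,
      (Polynomial.X - Polynomial.C t) * Polynomial.derivative f
        = (Polynomial.X - Polynomial.C t) ^ M * e₁ ∧
      (Polynomial.X - Polynomial.C t) ^ 2 * Polynomial.derivative (Polynomial.derivative f)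
        = (Polynomial.X - Polynomial.C t) ^ M * e₂ ∧
      e₁.eval t = M * e.eval t ∧ e₂.eval t = M * (M - 1) * e.eval t := by
  set e₁ := (M : Polynomial ℂ) * e + (Polynomial.X - Polynomial.C t) * Polynomial.derivative e
  have h1 : (Polynomial.X - Polynomial.C t) * Polynomial.derivative f
      = (Polynomial.X - Polynomial.C t) ^ M * e₁ := by
    rw [hf]; exact derivative_root_pow_mul t M e
  have h2 := derivative_root_pow_mul t M e₁
  rw [← h1] at h2
  refine ⟨e₁, ((M : Polynomial ℂ) - 1) * e₁
    + (Polynomial.X - Polynomial.C t) * Polynomial.derivative e₁, h1, ?_, ?_, ?_⟩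
  · simp only [Polynomial.derivative_mul, Polynomial.derivative_sub, Polynomial.derivative_X,
      Polynomial.derivative_C] at h2
    linear_combination h2 - h1
  · simp [e₁]
  · simp [e₁]; ring

lemma eval_opWW_of_root {t : ℂ} (h0 : f.eval t = 0) :
    (opWW k f).eval t = -2 * (k - 1) * t * (Polynomial.derivative f).eval t
      + t ^ 2 * (Polynomial.derivative (Polynomial.derivative f)).eval t := by
  simp [opWW, h0]; ring

lemma eval_opZW (t : ℂ) :
    (opZW k f).eval t = (k - 1) * (Polynomial.derivative f).eval t
      - t * (Polynomial.derivative (Polynomial.derivative f)).eval t := by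
  simp [opZW]

lemma root_pow_ne_zero (t : ℂ) (M : ℕ) : (Polynomial.X - Polynomial.C t) ^ M ≠ 0 :=
  pow_ne_zero M (Polynomial.X_sub_C_ne_zero t)

/-- Away from the origin, solutions with `c ≠ 1` only have simple roots. -/
lemma rootMultiplicity_le_one (hf0 : f ≠ 0) (hc : c ≠ 1)
    (h : opZZ f * opWW k f = Polynomial.C c * opZW k f ^ 2) {t : ℂ} (ht : t ≠ 0) :
    f.rootMultiplicity t ≤ 1 := by
  by_contra! hM
  obtain ⟨e, he, hdvd⟩ := Polynomial.exists_eq_pow_rootMultiplicity_mul_and_not_dvd f hf0 t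
  set M := f.rootMultiplicity t
  have het : e.eval t ≠ 0 := fun h => hdvd (Polynomial.dvd_iff_isRoot.2 h)
  obtain ⟨e₁, e₂, h1, h2, -, he2⟩ := exists_root_expansion t M e he
  set Y := Polynomial.X - Polynomial.C t with hY
  have hne : e₂.eval t ≠ 0 := by
    rw [he2]
    refine mul_ne_zero (mul_ne_zero ?_ ?_) het
    · exact_mod_cast (by omega : M ≠ 0)
    · rw [sub_ne_zero]; exact_mod_cast (by omega : M ≠ 1)
  have hb : Y ^ 2 * opWW k f = Y ^ M * ((k : Polynomial ℂ) * ((k : Polynomial ℂ) - 1) * Y ^ 2 * e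
      - 2 * ((k : Polynomial ℂ) - 1) * Polynomial.X * Y * e₁ + Polynomial.X ^ 2 * e₂) := by
    rw [opWW]
    linear_combination ((k : Polynomial ℂ) * ((k : Polynomial ℂ) - 1) * Y ^ 2) * he
      - 2 * ((k : Polynomial ℂ) - 1) * Polynomial.X * Y * h1 + Polynomial.X ^ 2 * h2
  have hh : Y ^ 2 * opZW k f = Y ^ M * (((k : Polynomial ℂ) - 1) * Y * e₁
      - Polynomial.X * e₂) := by
    rw [opZW]
    linear_combination ((k : Polynomial ℂ) - 1) * Y * h1 - Polynomial.X * h2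
  have ha : Y ^ 2 * opZZ f = Y ^ M * e₂ := h2
  have key : Y ^ (2 * M) * (e₂ * ((k : Polynomial ℂ) * ((k : Polynomial ℂ) - 1) * Y ^ 2 * e
      - 2 * ((k : Polynomial ℂ) - 1) * Polynomial.X * Y * e₁ + Polynomial.X ^ 2 * e₂))
      = Y ^ (2 * M) * (Polynomial.C c * (((k : Polynomial ℂ) - 1) * Y * e₁
        - Polynomial.X * e₂) ^ 2) := by
    have h4 : (Y ^ 2 * opZZ f) * (Y ^ 2 * opWW k f) = Polynomial.C c * (Y ^ 2 * opZW k f) ^ 2 := by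
      linear_combination Y ^ 4 * h
    rw [ha, hb, hh] at h4
    rw [pow_mul']
    linear_combination h4
  have key2 := congrArg (Polynomial.eval t) (mul_left_cancel₀ (root_pow_ne_zero t _) key)
  simp [hY] at key2
  apply hc
  apply mul_right_cancel₀ (mul_ne_zero (pow_ne_zero 2 ht) (pow_ne_zero 2 hne))
  linear_combination -key2

/-- A solution with `c ≠ 1` is determined by its two-jet at a nonzero simple root. -/
lemma eq_of_two_jet_eq (hc : c ≠ 1) (hk : 2 ≤ k)
    (hf : opZZ f * opWW k f = Polynomial.C c * opZW k f ^ 2)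
    (hg : opZZ g * opWW k g = Polynomial.C c * opZW k g ^ 2) {t : ℂ} (ht : t ≠ 0)
    (hf0 : f.eval t = 0) (hg0 : g.eval t = 0)
    (hf1 : (Polynomial.derivative f).eval t ≠ 0)
    (h1 : (Polynomial.derivative g).eval t = (Polynomial.derivative f).eval t)
    (h2 : (Polynomial.derivative (Polynomial.derivative g)).eval t
      = (Polynomial.derivative (Polynomial.derivative f)).eval t) : f = g := by
  by_contra hne
  set d := f - g with hd
  have hd0 : d ≠ 0 := sub_ne_zero.2 hne
  obtain ⟨e, he, hdvd⟩ := Polynomial.exists_eq_pow_rootMultiplicity_mul_and_not_dvd d hd0 t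
  set M := d.rootMultiplicity t
  have het : e.eval t ≠ 0 := fun h => hdvd (Polynomial.dvd_iff_isRoot.2 h)
  obtain ⟨e₁, e₂, g1, g2, he1, he2⟩ := exists_root_expansion t M e he
  set Y := Polynomial.X - Polynomial.C t with hY
  have hM0 : M ≠ 0 := by
    intro h
    rw [h, pow_zero, one_mul] at he
    apply het
    rw [← he, hd]
    simp [hf0, hg0]
  have hM1 : M ≠ 1 := by
    intro h
    rw [h, pow_one] at g1
    have g3 := mul_left_cancel₀ (Polynomial.X_sub_C_ne_zero t) g1
    rw [← g3, hd] at he1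
    simp [h1, h] at he1
    exact het he1.symm
  have hne2 : e₂.eval t ≠ 0 := by
    rw [he2]
    refine mul_ne_zero (mul_ne_zero ?_ ?_) het
    · exact_mod_cast hM0
    · rw [sub_ne_zero]; exact_mod_cast hM1
  have hlin : opZZ d * opWW k f + opZZ g * opWW k d
      - Polynomial.C c * opZW k d * (opZW k f + opZW k g) = 0 := by
    simp only [opZZ, opWW, opZW, hd, Polynomial.derivative_sub] at *
    linear_combination hf - hg
  have key : Y ^ M * (e₂ * opWW k f
      + opZZ g * ((k : Polynomial ℂ) * ((k : Polynomial ℂ) - 1) * Y ^ 2 * e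
        - 2 * ((k : Polynomial ℂ) - 1) * Polynomial.X * Y * e₁ + Polynomial.X ^ 2 * e₂)
      - Polynomial.C c * (((k : Polynomial ℂ) - 1) * Y * e₁ - Polynomial.X * e₂)
        * (opZW k f + opZW k g)) = Y ^ M * 0 := by
    have hb : Y ^ 2 * opWW k d = Y ^ M * ((k : Polynomial ℂ) * ((k : Polynomial ℂ) - 1) * Y ^ 2 * e
        - 2 * ((k : Polynomial ℂ) - 1) * Polynomial.X * Y * e₁ + Polynomial.X ^ 2 * e₂) := by
      rw [opWW]
      linear_combination ((k : Polynomial ℂ) * ((k : Polynomial ℂ) - 1) * Y ^ 2) * he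
        - 2 * ((k : Polynomial ℂ) - 1) * Polynomial.X * Y * g1 + Polynomial.X ^ 2 * g2
    have hh : Y ^ 2 * opZW k d = Y ^ M * (((k : Polynomial ℂ) - 1) * Y * e₁
        - Polynomial.X * e₂) := by
      rw [opZW]
      linear_combination ((k : Polynomial ℂ) - 1) * Y * g1 - Polynomial.X * g2
    have ha : Y ^ 2 * opZZ d = Y ^ M * e₂ := g2
    linear_combination Y ^ 2 * hlin - opWW k f * ha - opZZ g * hb
      + Polynomial.C c * (opZW k f + opZW k g) * hh
  have key2 := congrArg (Polynomial.eval t) (mul_left_cancel₀ (root_pow_ne_zero t _) key)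
  have hft := congrArg (Polynomial.eval t) hf
  simp only [Polynomial.eval_mul, Polynomial.eval_pow, Polynomial.eval_C, eval_opWW_of_root hf0,
    eval_opZW] at hft
  simp only [Polynomial.eval_mul, Polynomial.eval_add, Polynomial.eval_sub, Polynomial.eval_C,
    Polynomial.eval_X, Polynomial.eval_pow, Polynomial.eval_zero, hY, sub_self,
    eval_opWW_of_root hf0, eval_opZW, h1, h2] at key2
  simp only [opZZ, h2] at key2 hft
  generalize (Polynomial.derivative f).eval t = F₁ at *
  generalize (Polynomial.derivative (Polynomial.derivative f)).eval t = F₂ at *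
  have hk1 : (k : ℂ) - 1 ≠ 0 := by
    rw [sub_ne_zero]; exact_mod_cast (by omega : k ≠ 1)
  have h3 : t * F₂ = (k - 1) * F₁ := by
    have hnz : e₂.eval t * (2 * t) * (1 - c) ≠ 0 :=
      mul_ne_zero (mul_ne_zero hne2 (mul_ne_zero two_ne_zero ht)) (sub_ne_zero.2 hc.symm)
    apply mul_left_cancel₀ hnz
    linear_combination key2
  have h4 : ((k - 1) * F₁) ^ 2 = 0 := by
    have : t ≠ 0 := ht
    linear_combination -hft + (c * ((k - 1) * F₁ - t * F₂) - (k-1) * F₁ + t * F₂) * h3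
  exact mul_ne_zero hk1 hf1 (pow_eq_zero_iff two_ne_zero |>.1 h4)

end HomogeneousOperators

section Classification

variable {f : Polynomial ℂ} {k : ℕ} {c : ℂ}

lemma coeff_mul_two_mul {p q : Polynomial ℂ} {m : ℕ} (hp : ∀ i < m, p.coeff i = 0)
    (hq : ∀ i < m, q.coeff i = 0) : (p * q).coeff (2 * m) = p.coeff m * q.coeff m := by
  rw [Polynomial.coeff_mul, Finset.sum_eq_single (m, m)]
  · rintro ⟨i, j⟩ hij hne
    rw [Finset.HasAntidiagonal.mem_antidiagonal] at hij
    simp only at hij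
    rcases lt_trichotomy i m with h | h | h
    · simp [hp i h]
    · exact absurd (by ext <;> simp <;> omega) hne
    · simp [hq j (by omega)]
  · intro h
    exact absurd (Finset.HasAntidiagonal.mem_antidiagonal.2 (by simp; omega)) h

lemma coeff_mul_add_of_gap {p q : Polynomial ℂ} {m M : ℕ} (hmM : m < M)
    (hp : ∀ i < M, i ≠ m → p.coeff i = 0) (hq : ∀ i < M, i ≠ m → q.coeff i = 0) :
    (p * q).coeff (m + M) = p.coeff m * q.coeff M + p.coeff M * q.coeff m := by
  rw [Polynomial.coeff_mul, Finset.sum_eq_add (m, M) (M, m)]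
  · simp; omega
  · rintro ⟨i, j⟩ hij ⟨h1, h2⟩
    rw [Finset.HasAntidiagonal.mem_antidiagonal] at hij
    simp only [ne_eq, Prod.mk.injEq, not_and] at hij h1 h2
    by_cases him : i = m
    · exact absurd (by omega) (h1 him)
    by_cases hiM : i < M
    · simp [hp i hiM him]
    · by_cases hjm : j = m
      · exact absurd hjm (h2 (by omega))
      · simp [hq j (by omega) hjm]
  · intro h
    exact absurd (Finset.HasAntidiagonal.mem_antidiagonal.2 (by simp)) h
  · intro h
    exact absurd (Finset.HasAntidiagonal.mem_antidiagonal.2 (by simp; omega)) h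

lemma homogenized_equation (h : opZZ f * opWW k f = Polynomial.C c * opZW k f ^ 2) :
    (Polynomial.X ^ 2 * opZZ f) * opWW k f
      = Polynomial.C c * ((Polynomial.X * opZW k f) * (Polynomial.X * opZW k f)) := by
  linear_combination Polynomial.X ^ 2 * h

lemma coeff_equation_lowest (h : opZZ f * opWW k f = Polynomial.C c * opZW k f ^ 2) {m : ℕ}
    (hm : ∀ i < m, f.coeff i = 0) (hm0 : f.coeff m ≠ 0) :
    (m : ℂ) * (m - 1) * ((k - m) * (k - m - 1)) = c * (m * (k - m)) ^ 2 := by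
  have h1 := congrArg (Polynomial.coeff · (2 * m)) (homogenized_equation h)
  simp only [Polynomial.coeff_C_mul] at h1
  rw [coeff_mul_two_mul (fun i hi => by simp [coeff_X_sq_mul_opZZ, hm i hi])
      (fun i hi => by simp [coeff_opWW, hm i hi]),
    coeff_mul_two_mul (fun i hi => by simp [coeff_X_mul_opZW, hm i hi])
      (fun i hi => by simp [coeff_X_mul_opZW, hm i hi]),
    coeff_X_sq_mul_opZZ, coeff_X_mul_opZW, coeff_opWW] at h1
  apply mul_right_cancel₀ (pow_ne_zero 2 hm0)
  linear_combination h1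

lemma coeff_equation_gap (h : opZZ f * opWW k f = Polynomial.C c * opZW k f ^ 2) {m M : ℕ}
    (hmM : m < M) (hm : ∀ i < M, i ≠ m → f.coeff i = 0) (hm0 : f.coeff m ≠ 0)
    (hM0 : f.coeff M ≠ 0) :
    (m : ℂ) * (m - 1) * ((k - M) * (k - M - 1)) + M * (M - 1) * ((k - m) * (k - m - 1))
      = 2 * c * (m * (k - m) * (M * (k - M))) := by
  have h1 := congrArg (Polynomial.coeff · (m + M)) (homogenized_equation h)
  simp only [Polynomial.coeff_C_mul] at h1
  rw [coeff_mul_add_of_gap hmM (fun i hi hi' => by simp [coeff_X_sq_mul_opZZ, hm i hi hi'])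
      (fun i hi hi' => by simp [coeff_opWW, hm i hi hi']),
    coeff_mul_add_of_gap hmM (fun i hi hi' => by simp [coeff_X_mul_opZW, hm i hi hi'])
      (fun i hi hi' => by simp [coeff_X_mul_opZW, hm i hi hi'])] at h1
  simp only [coeff_X_sq_mul_opZZ, coeff_X_mul_opZW, coeff_opWW] at h1
  apply mul_right_cancel₀ (mul_ne_zero hm0 hM0)
  linear_combination h1

/-- The solutions for `c = 1` not vanishing at the origin are powers of linear forms. -/
lemma eq_C_mul_pow_of_eq_one (hk : 3 ≤ k) (hdeg : f.natDegree ≤ k)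
    (hsym : ‖f.coeff 0‖ = ‖f.coeff k‖) (h0 : f.coeff 0 ≠ 0)
    (h : opZZ f * opWW k f = opZW k f ^ 2) :
    ∃ a t : ℂ, ‖t‖ = 1 ∧ f = Polynomial.C a * (Polynomial.X - Polynomial.C t) ^ k := by
  have hkC : (k : Polynomial ℂ) - 1 ≠ 0 := by
    rw [sub_ne_zero]; exact_mod_cast (by omega : k ≠ 1)
  have hfk : f.coeff k ≠ 0 := by
    rw [← norm_ne_zero_iff, ← hsym]; exact norm_ne_zero_iff.2 h0
  have hf0 : f ≠ 0 := by rintro rfl; simp at h0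
  have hnd : f.natDegree = k := le_antisymm hdeg (Polynomial.le_natDegree_of_ne_zero hfk)
  have hode : (k : Polynomial ℂ) * f * opZZ f
      = ((k : Polynomial ℂ) - 1) * Polynomial.derivative f ^ 2 := by
    apply mul_left_cancel₀ hkC
    simp only [opZZ, opWW, opZW] at h ⊢
    linear_combination h
  obtain ⟨t, ht⟩ := Complex.exists_root (f := f)
    (Polynomial.natDegree_pos_iff_degree_pos.1 (by omega))
  obtain ⟨e, he, hdvd⟩ := Polynomial.exists_eq_pow_rootMultiplicity_mul_and_not_dvd f hf0 t
  have hMpos : 0 < f.rootMultiplicity t := (Polynomial.rootMultiplicity_pos hf0).2 ht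
  set M := f.rootMultiplicity t
  have het : e.eval t ≠ 0 := fun h => hdvd (Polynomial.dvd_iff_isRoot.2 h)
  obtain ⟨e₁, e₂, g1, g2, he1, he2⟩ := exists_root_expansion t M e he
  have key : (Polynomial.X - Polynomial.C t) ^ (2 * M) * ((k : Polynomial ℂ) * e * e₂)
      = (Polynomial.X - Polynomial.C t) ^ (2 * M) * (((k : Polynomial ℂ) - 1) * e₁ ^ 2) := by
    have h4 : (k : Polynomial ℂ) * f * ((Polynomial.X - Polynomial.C t) ^ 2 * opZZ f)
        = ((k : Polynomial ℂ) - 1)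
          * ((Polynomial.X - Polynomial.C t) * Polynomial.derivative f) ^ 2 := by
      linear_combination (Polynomial.X - Polynomial.C t) ^ 2 * hode
    rw [opZZ, g1, g2] at h4
    rw [pow_mul']
    linear_combination h4 - (k : Polynomial ℂ) * (Polynomial.X - Polynomial.C t) ^ M * e₂ * he
  have key2 := congrArg (Polynomial.eval t) (mul_left_cancel₀ (root_pow_ne_zero t _) key)
  simp [he1, he2] at key2
  have hMk : (M : ℂ) = k := by
    apply mul_left_cancel₀ (mul_ne_zero (Nat.cast_ne_zero.2 hMpos.ne' : (M : ℂ) ≠ 0)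
      (pow_ne_zero 2 het))
    linear_combination key2
  have hMk : M = k := by exact_mod_cast hMk
  have hene : e ≠ 0 := by rintro rfl; simp at het
  have hend : e.natDegree = 0 := by
    have := congrArg Polynomial.natDegree he
    rw [Polynomial.natDegree_mul (root_pow_ne_zero t _) hene, Polynomial.natDegree_pow,
      Polynomial.natDegree_X_sub_C] at this
    omega
  rw [Polynomial.eq_C_of_natDegree_eq_zero hend, hMk, mul_comm] at he
  refine ⟨_, t, ?_, he⟩
  have hmon := ((Polynomial.monic_X_sub_C t).pow k).coeff_natDegree
  rw [Polynomial.natDegree_pow, Polynomial.natDegree_X_sub_C, mul_one] at hmon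
  have hc0 : f.coeff 0 = e.coeff 0 * (-t) ^ k := by
    rw [he, Polynomial.coeff_zero_eq_eval_zero]; simp
  have hck : f.coeff k = e.coeff 0 := by
    rw [he, Polynomial.coeff_C_mul, hmon]; simp
  rw [hc0, hck] at hsym
  have he0 : ‖e.coeff 0‖ ≠ 0 := by rw [← hck]; exact norm_ne_zero_iff.2 hfk
  have h5 : ‖t‖ ^ k = 1 := by
    apply mul_left_cancel₀ he0
    simpa using hsym
  exact (pow_eq_one_iff_of_nonneg (norm_nonneg t) (by omega)).1 h5

lemma derivative_C_mul_comp_C_mul_X (f : Polynomial ℂ) (a ζ : ℂ) :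
    Polynomial.derivative (Polynomial.C a * f.comp (Polynomial.C ζ * Polynomial.X))
      = Polynomial.C (a * ζ)
        * (Polynomial.derivative f).comp (Polynomial.C ζ * Polynomial.X) := by
  simp [Polynomial.derivative_comp]; ring

/-- The equation is invariant under rescaling of the function and of the variable. -/
lemma equation_C_mul_comp (h : opZZ f * opWW k f = Polynomial.C c * opZW k f ^ 2) (a ζ : ℂ) :
    opZZ (Polynomial.C a * f.comp (Polynomial.C ζ * Polynomial.X))
      * opWW k (Polynomial.C a * f.comp (Polynomial.C ζ * Polynomial.X))
      = Polynomial.C c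
        * opZW k (Polynomial.C a * f.comp (Polynomial.C ζ * Polynomial.X)) ^ 2 := by
  have h1 := congrArg (Polynomial.comp · (Polynomial.C ζ * Polynomial.X)) h
  simp only [opZZ, opZW, opWW, Polynomial.mul_comp, Polynomial.sub_comp, Polynomial.add_comp,
    Polynomial.pow_comp, Polynomial.C_comp, Polynomial.X_comp, Polynomial.natCast_comp,
    Polynomial.one_comp, Polynomial.ofNat_comp] at h1
  simp only [opZZ, opZW, opWW, derivative_C_mul_comp_C_mul_X]
  simp only [Polynomial.C_mul]
  linear_combination Polynomial.C a ^ 2 * Polynomial.C ζ ^ 2 * h1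

/-- Two distinct simple roots with the same normalized two-jet produce a rotational symmetry,
which is impossible if the two lowest coefficients are nonzero. -/
lemma eq_of_normalized_two_jet_eq (hk : 2 ≤ k) (hc : c ≠ 1)
    (h : opZZ f * opWW k f = Polynomial.C c * opZW k f ^ 2) (h0 : f.coeff 0 ≠ 0)
    (h1 : f.coeff 1 ≠ 0) {s t : ℂ} (hs : s ≠ 0) (ht : t ≠ 0) (hfs : f.eval s = 0)
    (hft : f.eval t = 0) (hds : (Polynomial.derivative f).eval s ≠ 0)
    (hdt : (Polynomial.derivative f).eval t ≠ 0)
    (heq : s * (Polynomial.derivative (Polynomial.derivative f)).eval s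
        / (Polynomial.derivative f).eval s
      = t * (Polynomial.derivative (Polynomial.derivative f)).eval t
        / (Polynomial.derivative f).eval t) : s = t := by
  set a : ℂ := (Polynomial.derivative f).eval s * s / (t * (Polynomial.derivative f).eval t)
    with ha
  set g := Polynomial.C a * f.comp (Polynomial.C (t / s) * Polynomial.X) with hg
  have hfg : f = g := by
    refine eq_of_two_jet_eq hc hk h (equation_C_mul_comp h a (t / s)) hs hfs ?_ hds ?_ ?_
    · simp [hg, div_mul_cancel₀ t hs, hft]
    · rw [hg, derivative_C_mul_comp_C_mul_X]
      simp only [Polynomial.eval_mul, Polynomial.eval_C, Polynomial.eval_comp, Polynomial.eval_X,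
        div_mul_cancel₀ t hs, ha]
      field_simp
    · rw [hg, derivative_C_mul_comp_C_mul_X, derivative_C_mul_comp_C_mul_X]
      simp only [Polynomial.eval_mul, Polynomial.eval_C, Polynomial.eval_comp, Polynomial.eval_X,
        div_mul_cancel₀ t hs, ha]
      field_simp at heq ⊢
      linear_combination -heq
  have e0 := congrArg (Polynomial.coeff · 0) hfg
  have e1 := congrArg (Polynomial.coeff · 1) hfg
  simp only [hg, Polynomial.coeff_C_mul, Polynomial.comp_C_mul_X_coeff, pow_zero, mul_one,
    pow_one] at e0 e1
  have ha1 : a = 1 := by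
    apply mul_right_cancel₀ h0
    linear_combination -e0
  have hts : t / s = 1 := by
    apply mul_right_cancel₀ h1
    rw [ha1] at e1
    linear_combination -e1
  exact ((div_eq_one_iff_eq hs).1 hts).symm

/-- There is no solution with `c ≠ 1` whose coefficients of index `0`, `1`, `k` are nonzero. -/
lemma not_equation_of_coeff_ne_zero (hk : 3 ≤ k) (hc : c ≠ 1) (hdeg : f.natDegree ≤ k)
    (h : opZZ f * opWW k f = Polynomial.C c * opZW k f ^ 2) (h0 : f.coeff 0 ≠ 0)
    (h1 : f.coeff 1 ≠ 0) (hfk : f.coeff k ≠ 0) : False := by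
  have hf0 : f ≠ 0 := by rintro rfl; simp at h0
  have hnd : f.natDegree = k := le_antisymm hdeg (Polynomial.le_natDegree_of_ne_zero hfk)
  have hroot : ∀ t ∈ f.roots.toFinset, t ≠ 0 ∧ f.eval t = 0 := by
    intro t ht
    rw [Multiset.mem_toFinset, Polynomial.mem_roots hf0] at ht
    refine ⟨?_, ht⟩
    rintro rfl
    exact h0 (by rw [Polynomial.coeff_zero_eq_eval_zero]; exact ht)
  have hmult : ∀ t ∈ f.roots.toFinset, f.rootMultiplicity t ≤ 1 := fun t ht =>
    rootMultiplicity_le_one hf0 hc h (hroot t ht).1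
  have hder : ∀ t ∈ f.roots.toFinset, (Polynomial.derivative f).eval t ≠ 0 := by
    intro t ht hd
    have := (Polynomial.one_lt_rootMultiplicity_iff_isRoot hf0).2 ⟨(hroot t ht).2, hd⟩
    have := hmult t ht
    omega
  have hcard : 2 < f.roots.toFinset.card := by
    have hnodup : f.roots.Nodup := by
      rw [Multiset.nodup_iff_count_le_one]
      intro t
      by_cases ht : t ∈ f.roots
      · rw [Polynomial.count_roots]
        exact hmult t (Multiset.mem_toFinset.2 ht)
      · simp [Multiset.count_eq_zero_of_notMem ht]
    rw [Multiset.toFinset_card_of_nodup hnodup, IsAlgClosed.card_roots_eq_natDegree, hnd]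
    omega
  obtain ⟨x, hx, y, hy, z, hz, hxy, hxz, hyz⟩ := Finset.two_lt_card.1 hcard
  set G : ℂ → ℂ := fun t => t * (Polynomial.derivative (Polynomial.derivative f)).eval t
        / (Polynomial.derivative f).eval t with hG
  have hquad : ∀ t ∈ f.roots.toFinset, (1 - c) * (G t - (k - 1)) ^ 2 = (k - 1) ^ 2 := by
    intro t ht
    have hd := hder t ht
    have e := congrArg (Polynomial.eval t) h
    simp only [Polynomial.eval_mul, Polynomial.eval_pow, Polynomial.eval_C,
      eval_opWW_of_root (hroot t ht).2, eval_opZW, opZZ] at e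
    simp only [hG]
    field_simp
    linear_combination e
  have hinj : ∀ s ∈ f.roots.toFinset, ∀ t ∈ f.roots.toFinset, s ≠ t →
      G s - (k - 1) = -(G t - (k - 1)) := by
    intro s hs t ht hst
    have e : (G s - (k - 1)) ^ 2 = (G t - (k - 1)) ^ 2 :=
      mul_left_cancel₀ (sub_ne_zero.2 hc.symm) ((hquad s hs).trans (hquad t ht).symm)
    refine (sq_eq_sq_iff_eq_or_eq_neg.1 e).resolve_left fun e' => hst ?_
    exact eq_of_normalized_two_jet_eq (by omega) hc h h0 h1 (hroot s hs).1 (hroot t ht).1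
      (hroot s hs).2 (hroot t ht).2 (hder s hs) (hder t ht) (sub_left_injective e')
  have e1 := hinj x hx y hy hxy
  have e2 := hinj x hx z hz hxz
  have e3 := hinj y hy z hz hyz
  have hq := hquad x hx
  have : G x - ((k : ℂ) - 1) = 0 := by linear_combination (e1 + e2 - e3) / 2
  rw [this] at hq
  have hk1 : (k : ℂ) - 1 ≠ 0 := by
    rw [sub_ne_zero]; exact_mod_cast (by omega : k ≠ 1)
  exact pow_ne_zero 2 hk1 (by linear_combination -hq)

/-- Classification of the symmetric solutions. -/
theorem eq_C_mul_pow_or_eq_C_mul_X_pow (hk : 3 ≤ k) (hdeg : f.natDegree ≤ k)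
    (hsym : ∀ i j, i + j = k → f.coeff i = conj (f.coeff j)) (hH : opZW k f ≠ 0)
    (h : opZZ f * opWW k f = Polynomial.C c * opZW k f ^ 2) :
    (∃ a t : ℂ, ‖t‖ = 1 ∧ f = Polynomial.C a * (Polynomial.X - Polynomial.C t) ^ k) ∨
    ∃ (m : ℕ) (a : ℂ), a ≠ 0 ∧ k = 2 * m ∧ f = Polynomial.C a * Polynomial.X ^ m := by
  classical
  have hf0 : f ≠ 0 := by rintro rfl; simp [opZW] at hH
  have hlarge : ∀ i, k < i → f.coeff i = 0 := fun i hi =>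
    Polynomial.coeff_eq_zero_of_natDegree_lt (hdeg.trans_lt hi)
  have hsym0 : ∀ i j, i + j = k → f.coeff j ≠ 0 → f.coeff i ≠ 0 := fun i j hij hj => by
    rw [hsym i j hij]; simpa using hj
  have hex : ∃ i, f.coeff i ≠ 0 := by
    by_contra! hall
    exact hf0 (Polynomial.ext (by simpa using hall))
  obtain ⟨m, hm0, hm⟩ : ∃ m, f.coeff m ≠ 0 ∧ ∀ i < m, f.coeff i = 0 :=
    ⟨Nat.find hex, Nat.find_spec hex, fun i hi => by simpa using Nat.find_min hex hi⟩
  have hmk : 2 * m ≤ k := by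
    have h1 : m ≤ k := by by_contra! h1; exact hm0 (hlarge m h1)
    by_contra! h2
    exact hsym0 (k - m) m (by omega) hm0 (hm _ (by omega))
  have hlow := coeff_equation_lowest h hm hm0
  rcases Nat.eq_zero_or_pos m with rfl | hmpos
  · by_cases hc1 : c = 1
    · left
      refine eq_C_mul_pow_of_eq_one hk hdeg ?_ hm0 (by simpa [hc1] using h)
      rw [hsym 0 k (by omega)]; simp
    · exfalso
      refine not_equation_of_coeff_ne_zero hk hc1 hdeg h hm0 ?_
        (hsym0 k 0 (by omega) hm0)
      intro h1
      have hex2 : ∃ i, i ≠ 0 ∧ f.coeff i ≠ 0 := ⟨k, by omega, hsym0 k 0 (by omega) hm0⟩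
      obtain ⟨M, ⟨hMm, hM0⟩, hM⟩ : ∃ M, (M ≠ 0 ∧ f.coeff M ≠ 0) ∧
          ∀ i < M, ¬(i ≠ 0 ∧ f.coeff i ≠ 0) :=
        ⟨Nat.find hex2, Nat.find_spec hex2, fun i hi => Nat.find_min hex2 hi⟩
      have hM1 : M ≠ 1 := by rintro rfl; exact hM0 h1
      have hgap := coeff_equation_gap h (Nat.pos_of_ne_zero hMm)
        (fun i hi hi0 => by simpa [hi0] using hM i hi) hm0 hM0
      have hne : (M : ℂ) * (M - 1) * (k * (k - 1)) ≠ 0 := by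
        refine mul_ne_zero (mul_ne_zero ?_ ?_) (mul_ne_zero ?_ ?_)
        · exact_mod_cast hMm
        · rw [sub_ne_zero]; exact_mod_cast hM1
        · exact_mod_cast (by omega : k ≠ 0)
        · rw [sub_ne_zero]; exact_mod_cast (by omega : k ≠ 1)
      apply hne
      push_cast at hgap
      linear_combination hgap
  · right
    have hmC : (m : ℂ) ≠ 0 := by exact_mod_cast hmpos.ne'
    have hkmC : (k : ℂ) - m ≠ 0 := by
      rw [sub_ne_zero]; exact_mod_cast (by omega : k ≠ m)
    have hlow' : ((m : ℂ) - 1) * (k - m - 1) = c * (m * (k - m)) := by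
      apply mul_left_cancel₀ (mul_ne_zero hmC hkmC)
      linear_combination hlow
    have hone : ∀ M, M ≠ m → f.coeff M = 0 := by
      by_contra! hex2
      obtain ⟨M, ⟨hMm, hM0⟩, hM⟩ : ∃ M, (M ≠ m ∧ f.coeff M ≠ 0) ∧
          ∀ i < M, ¬(i ≠ m ∧ f.coeff i ≠ 0) :=
        ⟨Nat.find hex2, Nat.find_spec hex2, fun i hi => Nat.find_min hex2 hi⟩
      have hlt : m < M := by
        by_contra! hle
        exact hM0 (hm M (by omega))
      have hMk : M + m ≤ k := by
        by_contra! h2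
        rcases le_or_gt M k with h3 | h3
        · exact hsym0 (k - M) M (by omega) hM0 (hm _ (by omega))
        · exact hM0 (hlarge M h3)
      have hgap := coeff_equation_gap h hlt
        (fun i hi hi0 => by simpa [hi0] using hM i hi) hm0 hM0
      have e : ((m : ℂ) * (m - 1) * ((k - M) * (k - M - 1))
          + M * (M - 1) * ((k - m) * (k - m - 1)))
          = 2 * (M * (k - M)) * ((m - 1) * (k - m - 1)) := by
        rw [hlow']; linear_combination hgap
      have eR : ((m : ℝ) * (m - 1) * ((k - M) * (k - M - 1))
          + M * (M - 1) * ((k - m) * (k - m - 1)))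
          = 2 * (M * (k - M)) * ((m - 1) * (k - m - 1)) := by exact_mod_cast e
      have hMR : (m : ℝ) + 1 ≤ M := by exact_mod_cast hlt
      have hkR : (3 : ℝ) ≤ k := by exact_mod_cast hk
      have hmkR : 2 * (m : ℝ) ≤ k := by exact_mod_cast hmk
      have hfac : ((k : ℝ) - 1) * (M - m) * ((k - 2) * M - (m - 1) * k) = 0 := by
        linear_combination eR
      have hpos : 0 < ((k : ℝ) - 2) * M - (m - 1) * k := by nlinarith
      have hpos' : 0 < ((k : ℝ) - 1) * (M - m) := mul_pos (by linarith) (by linarith)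
      exact (mul_pos hpos' hpos).ne' hfac
    have hkm : k = 2 * m := by
      by_contra hne
      exact hsym0 (k - m) m (by omega) hm0 (hone _ (by omega))
    refine ⟨m, f.coeff m, hm0, hkm, ?_⟩
    ext i
    rw [Polynomial.coeff_C_mul_X_pow]
    split_ifs with hi
    · rw [hi]
    · exact hone i hi

end Classification

section FormalSolutions

/-- The homogeneous components of `u_{zz̄}`. -/
noncomputable def mixedSeq (F : ℕ → Polynomial ℂ) (n : ℕ) : Polynomial ℂ :=
  opZW (n + 2) (F (n + 2))

/-- The homogeneous components of `u_{zz} u_{z̄z̄}`. -/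
noncomputable def pureSeq (F : ℕ → Polynomial ℂ) (n : ℕ) : Polynomial ℂ :=
  ∑ ij ∈ Finset.HasAntidiagonal.antidiagonal n,
    opZZ (F (ij.1 + 2)) * opWW (ij.2 + 2) (F (ij.2 + 2))

/-- The functional dependence of `u_{zz̄}` and `u_{zz} u_{z̄z̄}`, degree by degree. -/
def FormalJacobianEqZero (F : ℕ → Polynomial ℂ) : Prop :=
  ∀ N, ∑ ij ∈ Finset.HasAntidiagonal.antidiagonal N,
    (((ij.2 + 1 : ℕ) : Polynomial ℂ) * Polynomial.derivative (mixedSeq F (ij.1 + 1))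
        * pureSeq F (ij.2 + 1)
      - ((ij.1 + 1 : ℕ) : Polynomial ℂ) * mixedSeq F (ij.1 + 1)
        * Polynomial.derivative (pureSeq F (ij.2 + 1))) = 0

variable {F : ℕ → Polynomial ℂ} {K m n : ℕ} {a b : ℂ}

lemma opZZ_of_lt (h2 : F 2 = Polynomial.C b * Polynomial.X)
    (hF : ∀ n < K + 2, n ≠ 2 → F n = 0) {i : ℕ} (hi : i < K) : opZZ (F (i + 2)) = 0 := by
  cases i with
  | zero => simp [h2, opZZ]
  | succ i => simp [hF (i + 1 + 2) (by omega) (by omega), opZZ]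

lemma opWW_of_lt (h2 : F 2 = Polynomial.C b * Polynomial.X)
    (hF : ∀ n < K + 2, n ≠ 2 → F n = 0) {i : ℕ} (hi : i < K) :
    opWW (i + 2) (F (i + 2)) = 0 := by
  cases i with
  | zero => simp [h2, opWW]
  | succ i => simp [hF (i + 1 + 2) (by omega) (by omega), opWW]

lemma mixedSeq_of_lt (hF : ∀ n < K + 2, n ≠ 2 → F n = 0) {i : ℕ} (h0 : i ≠ 0) (hi : i < K) :
    mixedSeq F i = 0 := by
  simp [mixedSeq, hF (i + 2) (by omega) (by omega), opZW]

lemma pureSeq_of_lt (h2 : F 2 = Polynomial.C b * Polynomial.X)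
    (hF : ∀ n < K + 2, n ≠ 2 → F n = 0) (hn : n < 2 * K) : pureSeq F n = 0 := by
  refine Finset.sum_eq_zero fun ij hij => ?_
  rw [Finset.HasAntidiagonal.mem_antidiagonal] at hij
  rcases lt_or_ge ij.1 K with h | h
  · rw [opZZ_of_lt h2 hF h, zero_mul]
  · rw [opWW_of_lt h2 hF (by omega), mul_zero]

lemma pureSeq_two_mul (h2 : F 2 = Polynomial.C b * Polynomial.X)
    (hF : ∀ n < K + 2, n ≠ 2 → F n = 0) :
    pureSeq F (2 * K) = opZZ (F (K + 2)) * opWW (K + 2) (F (K + 2)) := by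
  rw [pureSeq, Finset.sum_eq_single (K, K)]
  · rintro ⟨i, j⟩ hij hne
    rw [Finset.HasAntidiagonal.mem_antidiagonal] at hij
    simp only at hij
    rcases lt_trichotomy i K with h | h | h
    · simp only; rw [opZZ_of_lt h2 hF h, zero_mul]
    · exact absurd (by ext <;> simp <;> omega) hne
    · simp only; rw [opWW_of_lt h2 hF (by omega), mul_zero]
  · intro h
    exact absurd (Finset.HasAntidiagonal.mem_antidiagonal.2 (by simp; omega)) h

/-- The lowest-order part of the equation. -/
lemma exists_leading_equation (hK : 1 ≤ K) (hJ : FormalJacobianEqZero F)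
    (h2 : F 2 = Polynomial.C b * Polynomial.X) (hF : ∀ n < K + 2, n ≠ 2 → F n = 0)
    (hH : opZW (K + 2) (F (K + 2)) ≠ 0) :
    ∃ c, opZZ (F (K + 2)) * opWW (K + 2) (F (K + 2))
      = Polynomial.C c * opZW (K + 2) (F (K + 2)) ^ 2 := by
  refine exists_eq_C_mul_sq hH ?_
  have h := hJ (3 * K - 2)
  rw [Finset.sum_eq_single (K - 1, 2 * K - 1)] at h
  · simp only [show K - 1 + 1 = K by omega, show 2 * K - 1 + 1 = 2 * K by omega,
      pureSeq_two_mul h2 hF] at h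
    have hKne : (K : Polynomial ℂ) ≠ 0 := by exact_mod_cast (by omega : K ≠ 0)
    apply mul_left_cancel₀ hKne
    simp only [mixedSeq] at h
    push_cast at h
    linear_combination h
  · rintro ⟨i, j⟩ hij hne
    rw [Finset.HasAntidiagonal.mem_antidiagonal] at hij
    simp only at hij
    rcases lt_trichotomy (i + 1) K with h | h | h
    · simp [mixedSeq_of_lt hF (by omega) h]
    · exact absurd (by ext <;> simp <;> omega) hne
    · simp [pureSeq_of_lt h2 hF (show j + 1 < 2 * K by omega)]
  · intro h
    exact absurd (Finset.HasAntidiagonal.mem_antidiagonal.2 (by simp; omega)) h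

/-- The deviation of a dehomogenized form of weight `N` from being radial. -/
noncomputable def radialDefect (N : ℤ) (g : Polynomial ℂ) : Polynomial ℂ :=
  2 * (Polynomial.X * Polynomial.derivative g) - (N : Polynomial ℂ) * g

lemma radialDefect_mul (M N : ℤ) (g h : Polynomial ℂ) :
    radialDefect (M + N) (g * h) = radialDefect M g * h + g * radialDefect N h := by
  simp [radialDefect]; ring

lemma radialDefect_sum {ι : Type*} (N : ℤ) (s : Finset ι) (g : ι → Polynomial ℂ) :
    radialDefect N (∑ i ∈ s, g i) = ∑ i ∈ s, radialDefect N (g i) := by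
  simp [radialDefect, Finset.mul_sum, Finset.sum_sub_distrib]

lemma radialDefect_opZZ (n : ℕ) (f : Polynomial ℂ) :
    radialDefect (n - 2) (opZZ f) = opZZ (radialDefect (n + 2) f) := by
  simp [radialDefect, opZZ]; ring

lemma radialDefect_opZW (n : ℕ) (f : Polynomial ℂ) :
    radialDefect n (opZW (n + 2) f) = opZW (n + 2) (radialDefect (n + 2) f) := by
  simp [radialDefect, opZW]; ring

lemma radialDefect_opWW (n : ℕ) (f : Polynomial ℂ) :
    radialDefect (n + 2) (opWW (n + 2) f) = opWW (n + 2) (radialDefect (n + 2) f) := by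
  simp [radialDefect, opWW]; ring

lemma radialDefect_pureSeq_term (F : ℕ → Polynomial ℂ) (i j : ℕ) :
    radialDefect ((i + j : ℕ) : ℤ) (opZZ (F (i + 2)) * opWW (j + 2) (F (j + 2)))
      = opZZ (radialDefect (i + 2) (F (i + 2))) * opWW (j + 2) (F (j + 2))
        + opZZ (F (i + 2)) * opWW (j + 2) (radialDefect (j + 2) (F (j + 2))) := by
  rw [show ((i + j : ℕ) : ℤ) = ((i : ℤ) - 2) + (j + 2) by push_cast; ring, radialDefect_mul,
    radialDefect_opZZ, radialDefect_opWW]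

lemma radialDefect_mixedSeq_of_lt (hrad : ∀ i < n + 2, radialDefect i (F i) = 0) {i : ℕ}
    (hi : i < n) : radialDefect i (mixedSeq F i) = 0 := by
  have := hrad (i + 2) (by omega)
  push_cast at this
  rw [mixedSeq, radialDefect_opZW, this]
  simp [opZW]

lemma radialDefect_pureSeq_of_lt (h2 : F 2 = Polynomial.C b * Polynomial.X)
    (hF : ∀ n < K + 2, n ≠ 2 → F n = 0) (hrad : ∀ i < n + 2, radialDefect i (F i) = 0) {q : ℕ}
    (hq : q < K + n) : radialDefect q (pureSeq F q) = 0 := by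
  rw [pureSeq, radialDefect_sum]
  refine Finset.sum_eq_zero fun ij hij => ?_
  rw [Finset.HasAntidiagonal.mem_antidiagonal] at hij
  have hzero : ∀ i < n, radialDefect (i + 2) (F (i + 2)) = 0 := fun i hi => by
    have := hrad (i + 2) (by omega)
    exact_mod_cast this
  rw [← hij, radialDefect_pureSeq_term]
  have e1 : opZZ (radialDefect (ij.1 + 2) (F (ij.1 + 2))) * opWW (ij.2 + 2) (F (ij.2 + 2)) = 0 := by
    rcases lt_or_ge ij.1 n with h | h
    · rw [hzero _ h]; simp [opZZ]
    · rw [opWW_of_lt h2 hF (by omega), mul_zero]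
  have e2 : opZZ (F (ij.1 + 2)) * opWW (ij.2 + 2) (radialDefect (ij.2 + 2) (F (ij.2 + 2))) = 0 := by
    rcases lt_or_ge ij.2 n with h | h
    · rw [hzero _ h]; simp [opWW]
    · rw [opZZ_of_lt h2 hF (by omega), zero_mul]
  rw [e1, e2, add_zero]

lemma radialDefect_pureSeq_add (h2 : F 2 = Polynomial.C b * Polynomial.X)
    (hF : ∀ n < K + 2, n ≠ 2 → F n = 0) (hn : K < n)
    (hrad : ∀ i < n + 2, radialDefect i (F i) = 0) :
    radialDefect ((K + n : ℕ) : ℤ) (pureSeq F (K + n))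
      = opZZ (F (K + 2)) * opWW (n + 2) (radialDefect (n + 2) (F (n + 2)))
        + opZZ (radialDefect (n + 2) (F (n + 2))) * opWW (K + 2) (F (K + 2)) := by
  have hzero : ∀ i < n, radialDefect (i + 2) (F (i + 2)) = 0 := fun i hi => by
    have := hrad (i + 2) (by omega)
    exact_mod_cast this
  rw [pureSeq, radialDefect_sum, Finset.sum_eq_add (K, n) (n, K)]
  · simp only
    rw [radialDefect_pureSeq_term, add_comm K n, radialDefect_pureSeq_term, hzero K hn]
    simp [opZZ, opWW]
  · simp; omega
  · rintro ⟨i, j⟩ hij ⟨h1, h2'⟩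
    rw [Finset.HasAntidiagonal.mem_antidiagonal] at hij
    simp only [ne_eq, Prod.mk.injEq, not_and] at hij h1 h2'
    simp only
    rw [← hij, radialDefect_pureSeq_term]
    have e1 : opZZ (radialDefect (i + 2) (F (i + 2))) * opWW (j + 2) (F (j + 2)) = 0 := by
      rcases lt_or_ge i n with h | h
      · rw [hzero _ h]; simp [opZZ]
      · rw [opWW_of_lt h2 hF (by omega), mul_zero]
    have e2 : opZZ (F (i + 2)) * opWW (j + 2) (radialDefect (j + 2) (F (j + 2))) = 0 := by
      rcases lt_or_ge j n with h | h
      · rw [hzero _ h]; simp [opWW]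
      · rw [opZZ_of_lt h2 hF (by omega), zero_mul]
    rw [e1, e2, add_zero]
  · intro h
    exact absurd (Finset.HasAntidiagonal.mem_antidiagonal.2 (by simp)) h
  · intro h
    exact absurd (Finset.HasAntidiagonal.mem_antidiagonal.2 (by simp; omega)) h

/-- The linearized equation satisfied by the first non-radial component. -/
lemma radialDefect_equation (hK : 1 ≤ K) (hJ : FormalJacobianEqZero F)
    (h2 : F 2 = Polynomial.C b * Polynomial.X) (hF : ∀ n < K + 2, n ≠ 2 → F n = 0) (hn : K < n)
    (hrad : ∀ i < n + 2, radialDefect i (F i) = 0) :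
    2 * (opZZ (F (K + 2)) * opWW (K + 2) (F (K + 2)))
        * opZW (n + 2) (radialDefect (n + 2) (F (n + 2)))
      = opZW (K + 2) (F (K + 2))
        * (opZZ (F (K + 2)) * opWW (n + 2) (radialDefect (n + 2) (F (n + 2)))
        + opZZ (radialDefect (n + 2) (F (n + 2))) * opWW (K + 2) (F (K + 2))) := by
  have h := hJ (2 * K + n - 2)
  rw [Finset.sum_eq_add (K - 1, K + n - 1) (n - 1, 2 * K - 1)] at h
  · simp only [show K - 1 + 1 = K by omega, show 2 * K - 1 + 1 = 2 * K by omega,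
      show n - 1 + 1 = n by omega, show K + n - 1 + 1 = K + n by omega] at h
    have hE := radialDefect_pureSeq_of_lt h2 hF hrad (show 2 * K < K + n by omega)
    have hHK := radialDefect_mixedSeq_of_lt hrad hn
    have hEn := radialDefect_pureSeq_add h2 hF hn hrad
    have hHn := radialDefect_opZW n (F (n + 2))
    rw [← hEn, ← hHn, ← pureSeq_two_mul h2 hF, ← mixedSeq, ← mixedSeq]
    have hKne : (K : Polynomial ℂ) ≠ 0 := by exact_mod_cast (by omega : K ≠ 0)
    apply mul_left_cancel₀ hKne
    simp only [radialDefect] at hE hHK ⊢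
    push_cast at h hE hHK ⊢
    linear_combination 2 * Polynomial.X * h
      - ((K : Polynomial ℂ) + n) * pureSeq F (K + n) * hHK + n * mixedSeq F n * hE
  · simp; omega
  · rintro ⟨i, j⟩ hij ⟨h1, h2'⟩
    rw [Finset.HasAntidiagonal.mem_antidiagonal] at hij
    simp only [ne_eq, Prod.mk.injEq, not_and] at hij h1 h2'
    simp only
    rcases lt_or_ge (i + 1) K with h3 | h3
    · simp [mixedSeq_of_lt hF (by omega) h3]
    rcases lt_or_ge (j + 1) (2 * K) with h4 | h4
    · simp [pureSeq_of_lt h2 hF h4]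
    have hi : i + 1 < n := by omega
    have hE := radialDefect_pureSeq_of_lt h2 hF hrad (show j + 1 < K + n by omega)
    have hHi := radialDefect_mixedSeq_of_lt hrad hi
    have h2X : (2 : Polynomial ℂ) * Polynomial.X ≠ 0 := mul_ne_zero two_ne_zero Polynomial.X_ne_zero
    apply mul_left_cancel₀ h2X
    simp only [radialDefect] at hE hHi
    push_cast at hE hHi ⊢
    linear_combination ((j : Polynomial ℂ) + 1) * pureSeq F (j + 1) * hHi
      - ((i : Polynomial ℂ) + 1) * mixedSeq F (i + 1) * hE
  · intro h
    exact absurd (Finset.HasAntidiagonal.mem_antidiagonal.2 (by simp; omega)) h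
  · intro h
    exact absurd (Finset.HasAntidiagonal.mem_antidiagonal.2 (by simp; omega)) h

/-- The linearized equation at a radial leading form has no nonzero solution. -/
lemma eq_zero_of_linearized_equation {f g : Polynomial ℂ} (hm : 2 ≤ m) (ha : a ≠ 0)
    (hf : f = Polynomial.C a * Polynomial.X ^ m) (hn : 2 * m < n)
    (h : 2 * (opZZ f * opWW (2 * m) f) * opZW n g
      = opZW (2 * m) f * (opZZ f * opWW n g + opZZ g * opWW (2 * m) f)) : g = 0 := by
  have hA : Polynomial.X ^ 2 * opZZ f
      = Polynomial.C (a * m * (m - 1)) * Polynomial.X ^ m := by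
    ext i
    rw [coeff_X_sq_mul_opZZ, hf, Polynomial.coeff_C_mul_X_pow, Polynomial.coeff_C_mul_X_pow]
    split_ifs with hi
    · rw [hi]; ring
    · simp
  have hB : opWW (2 * m) f = Polynomial.C (a * m * (m - 1)) * Polynomial.X ^ m := by
    ext i
    rw [coeff_opWW, hf, Polynomial.coeff_C_mul_X_pow, Polynomial.coeff_C_mul_X_pow]
    split_ifs with hi
    · rw [hi]; push_cast; ring
    · simp
  have hH : Polynomial.X * opZW (2 * m) f = Polynomial.C (a * m ^ 2) * Polynomial.X ^ m := by
    ext i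
    rw [coeff_X_mul_opZW, hf, Polynomial.coeff_C_mul_X_pow, Polynomial.coeff_C_mul_X_pow]
    split_ifs with hi
    · rw [hi]; push_cast; ring
    · simp
  have hmC : (m : ℂ) ≠ 0 := by exact_mod_cast (by omega : m ≠ 0)
  have hmC1 : (m : ℂ) - 1 ≠ 0 := by
    rw [sub_ne_zero]; exact_mod_cast (by omega : m ≠ 1)
  have key : Polynomial.C (2 * ((m : ℂ) - 1)) * (Polynomial.X * opZW n g)
      = Polynomial.C (m : ℂ) * (opWW n g + Polynomial.X ^ 2 * opZZ g) := by
    have hne : Polynomial.C (a ^ 2 * m ^ 2 * (m - 1)) * (Polynomial.X ^ m) ^ 2 ≠ 0 :=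
      mul_ne_zero (Polynomial.C_ne_zero.2 (by positivity))
        (pow_ne_zero _ (pow_ne_zero _ Polynomial.X_ne_zero))
    apply mul_left_cancel₀ hne
    have h3 : 2 * ((Polynomial.X ^ 2 * opZZ f) * opWW (2 * m) f) * (Polynomial.X * opZW n g)
        = (Polynomial.X * opZW (2 * m) f) * ((Polynomial.X ^ 2 * opZZ f) * opWW n g
          + (Polynomial.X ^ 2 * opZZ g) * opWW (2 * m) f) := by
      linear_combination Polynomial.X ^ 3 * h
    rw [hA, hB, hH] at h3
    simp only [map_mul, map_pow, map_sub, map_one, map_ofNat] at h3 ⊢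
    linear_combination h3
  ext i
  have hi := congrArg (Polynomial.coeff · i) key
  simp only [Polynomial.coeff_C_mul, Polynomial.coeff_add, coeff_X_mul_opZW, coeff_opWW,
    coeff_X_sq_mul_opZZ] at hi
  have hz : (((m * n * (n - 1) - (4 * m - 2) * (i * (n - i)) : ℝ)) : ℂ) * g.coeff i = 0 := by
    push_cast
    linear_combination -hi
  refine (mul_eq_zero.1 hz).resolve_left (Complex.ofReal_ne_zero.2 (ne_of_gt ?_))
  have h4 : 4 * ((i : ℝ) * (n - i)) ≤ n ^ 2 := by nlinarith [sq_nonneg ((n : ℝ) - 2 * i)]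
  have hmR : (2 : ℝ) ≤ m := by exact_mod_cast hm
  have hnR : 2 * (m : ℝ) + 1 ≤ n := by exact_mod_cast hn
  nlinarith [mul_le_mul_of_nonneg_left h4 (by linarith : (0 : ℝ) ≤ 4 * m - 2)]

/-- A formal solution with radial leading part is radial. -/
theorem radialDefect_eq_zero (hm : 2 ≤ m) (ha : a ≠ 0) (hJ : FormalJacobianEqZero F)
    (h2 : F 2 = Polynomial.C b * Polynomial.X) (hF : ∀ n < 2 * m, n ≠ 2 → F n = 0)
    (hlead : F (2 * m) = Polynomial.C a * Polynomial.X ^ m) (n : ℕ) :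
    radialDefect n (F n) = 0 := by
  obtain ⟨K, hK⟩ : ∃ K, 2 * m = K + 2 := ⟨2 * m - 2, by omega⟩
  induction n using Nat.strong_induction_on with
  | _ n ih =>
    rcases lt_trichotomy n (2 * m) with h | h | h
    · by_cases hn2 : n = 2
      · subst hn2; rw [h2]; simp [radialDefect]
      · simp [hF n h hn2, radialDefect]
    · rw [h, hlead, radialDefect]
      obtain ⟨m, rfl⟩ : ∃ m', m = m' + 1 := ⟨m - 1, by omega⟩
      simp; ring
    · obtain ⟨n, rfl⟩ : ∃ n', n = n' + 2 := ⟨n - 2, by omega⟩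
      have heq := radialDefect_equation (by omega) hJ h2 (hK ▸ hF) (by omega : K < n) ih
      rw [← hK] at heq
      push_cast
      exact eq_zero_of_linearized_equation hm ha hlead h heq

end FormalSolutions

section Jets

variable {U : ℝ × ℝ → ℂ}

lemma jet_wirtZ_wirtZ (hU : AnalyticAt ℝ U 0) (n : ℕ) :
    jet n (wirtZ (wirtZ U)) = opZZ (jet (n + 2) U) := by
  rw [← derivative_jet n hU.wirtZ, ← derivative_jet (n + 1) hU, opZZ]

lemma jet_wirtW_wirtZ (hU : AnalyticAt ℝ U 0) (n : ℕ) :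
    jet n (wirtW (wirtZ U)) = opZW (n + 2) (jet (n + 2) U) := by
  rw [jet_wirtW n hU.wirtZ, ← derivative_jet (n + 1) hU, opZW]
  push_cast; ring

lemma jet_wirtW_wirtW (hU : AnalyticAt ℝ U 0) (n : ℕ) :
    jet n (wirtW (wirtW U)) = opWW (n + 2) (jet (n + 2) U) := by
  rw [jet_wirtW n hU.wirtW, jet_wirtW (n + 1) hU, opWW]
  simp; ring

lemma formalJacobianEqZero_jet (hU : AnalyticAt ℝ U 0)
    (hJ : wirtZ (wirtW (wirtZ U)) * wirtW (wirtZ (wirtZ U) * wirtW (wirtW U))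
      =ᶠ[𝓝 0] wirtW (wirtW (wirtZ U)) * wirtZ (wirtZ (wirtZ U) * wirtW (wirtW U))) :
    FormalJacobianEqZero fun n => jet n U := by
  have hh := hU.wirtZ.wirtW
  have he : AnalyticAt ℝ (wirtZ (wirtZ U) * wirtW (wirtW U)) 0 := hU.wirtZ.wirtZ.mul hU.wirtW.wirtW
  have hH : ∀ n, mixedSeq (fun n => jet n U) n = jet n (wirtW (wirtZ U)) := fun n =>
    (jet_wirtW_wirtZ hU n).symm
  have hE : ∀ n, pureSeq (fun n => jet n U) n = jet n (wirtZ (wirtZ U) * wirtW (wirtW U)) := by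
    intro n
    simp only [jet_mul n hU.wirtZ.wirtZ hU.wirtW.wirtW, pureSeq, jet_wirtZ_wirtZ hU,
      jet_wirtW_wirtW hU]
  intro N
  have h := jet_congr N hJ
  rw [jet_mul N hh.wirtZ he.wirtW, jet_mul N hh.wirtW he.wirtZ, ← sub_eq_zero,
    ← Finset.sum_sub_distrib] at h
  rw [← h]
  refine Finset.sum_congr rfl fun ij _ => ?_
  simp only [hH, hE, jet_wirtW _ he, jet_wirtW _ hh, ← derivative_jet _ he, ← derivative_jet _ hh]
  push_cast
  ring

end Jets

section RealFunctions

variable {f : ℝ × ℝ → ℝ} {p : ℝ × ℝ}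

lemma hasFDerivAt_ofReal_comp (hf : AnalyticAt ℝ f p) :
    HasFDerivAt (fun q => (f q : ℂ)) (Complex.ofRealCLM.comp (fderiv ℝ f p)) p :=
  (Complex.ofRealCLM.hasFDerivAt (x := f p)).comp p hf.differentiableAt.hasFDerivAt

lemma pdx_eq_fderiv (hf : AnalyticAt ℝ f p) : pdx f p = fderiv ℝ f p (1, 0) := by
  have h : HasDerivAt (fun x : ℝ => (x, p.2)) ((1 : ℝ), (0 : ℝ)) p.1 :=
    (hasDerivAt_id p.1).prodMk (hasDerivAt_const p.1 p.2)
  exact (hf.differentiableAt.hasFDerivAt.comp_hasDerivAt p.1 h).deriv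

lemma pdy_eq_fderiv (hf : AnalyticAt ℝ f p) : pdy f p = fderiv ℝ f p (0, 1) := by
  have h : HasDerivAt (fun y : ℝ => (p.1, y)) ((0 : ℝ), (1 : ℝ)) p.2 :=
    (hasDerivAt_const p.2 p.1).prodMk (hasDerivAt_id p.2)
  exact (hf.differentiableAt.hasFDerivAt.comp_hasDerivAt p.2 h).deriv

lemma AnalyticAt.pdx (hf : AnalyticAt ℝ f p) : AnalyticAt ℝ (pdx f) p :=
  (((ContinuousLinearMap.apply ℝ ℝ ((1 : ℝ), (0 : ℝ))).analyticAt _).comp hf.fderiv).congr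
    (hf.eventually_analyticAt.mono fun _ hq => (pdx_eq_fderiv hq).symm)

lemma AnalyticAt.pdy (hf : AnalyticAt ℝ f p) : AnalyticAt ℝ (pdy f) p :=
  (((ContinuousLinearMap.apply ℝ ℝ ((0 : ℝ), (1 : ℝ))).analyticAt _).comp hf.fderiv).congr
    (hf.eventually_analyticAt.mono fun _ hq => (pdy_eq_fderiv hq).symm)

lemma AnalyticAt.ofReal_comp (hf : AnalyticAt ℝ f p) : AnalyticAt ℝ (fun q => (f q : ℂ)) p :=
  (Complex.ofRealCLM.analyticAt _).comp hf

lemma ofReal_pdx (hf : AnalyticAt ℝ f p) :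
    (pdx f p : ℂ) = fderiv ℝ (fun q => (f q : ℂ)) p (1, 0) := by
  rw [(hasFDerivAt_ofReal_comp hf).fderiv, pdx_eq_fderiv hf]; rfl

lemma ofReal_pdy (hf : AnalyticAt ℝ f p) :
    (pdy f p : ℂ) = fderiv ℝ (fun q => (f q : ℂ)) p (0, 1) := by
  rw [(hasFDerivAt_ofReal_comp hf).fderiv, pdy_eq_fderiv hf]; rfl

lemma fderiv_fderiv_apply {g : ℝ × ℝ → ℂ} (hg : AnalyticAt ℝ g p) (v w : ℝ × ℝ) :
    fderiv ℝ (fun q => fderiv ℝ g q w) p v = fderiv ℝ (fderiv ℝ g) p v w := by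
  have h := hg.fderiv.differentiableAt.hasFDerivAt.clm_apply (hasFDerivAt_const w p)
  rw [h.fderiv]; simp

lemma fderiv_ofReal_pdx (hf : AnalyticAt ℝ f p) (v : ℝ × ℝ) :
    fderiv ℝ (fun q => (pdx f q : ℂ)) p v
      = fderiv ℝ (fderiv ℝ fun q => (f q : ℂ)) p v (1, 0) := by
  rw [← fderiv_fderiv_apply hf.ofReal_comp]
  congr 1
  exact Filter.EventuallyEq.fderiv_eq (hf.eventually_analyticAt.mono fun _ hq => ofReal_pdx hq)

lemma fderiv_ofReal_pdy (hf : AnalyticAt ℝ f p) (v : ℝ × ℝ) :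
    fderiv ℝ (fun q => (pdy f q : ℂ)) p v
      = fderiv ℝ (fderiv ℝ fun q => (f q : ℂ)) p v (0, 1) := by
  rw [← fderiv_fderiv_apply hf.ofReal_comp]
  congr 1
  exact Filter.EventuallyEq.fderiv_eq (hf.eventually_analyticAt.mono fun _ hq => ofReal_pdy hq)

lemma fderiv_fderiv_comm {g : ℝ × ℝ → ℂ} (hg : AnalyticAt ℝ g p) :
    fderiv ℝ (fderiv ℝ g) p (1, 0) (0, 1) = fderiv ℝ (fderiv ℝ g) p (0, 1) (1, 0) :=
  (hg.contDiffAt (n := 2)).isSymmSndFDerivAt (by simp) |>.eq _ _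

lemma ofReal_lap (hf : AnalyticAt ℝ f p) :
    (lap f p : ℂ) = 4 * wirtW (wirtZ fun q => (f q : ℂ)) p := by
  have hs := fderiv_fderiv_comm hf.ofReal_comp
  rw [wirtW, fderiv_wirtZ hf.ofReal_comp, fderiv_wirtZ hf.ofReal_comp, lap, Complex.ofReal_add,
    ofReal_pdx hf.pdx, ofReal_pdy hf.pdy, fderiv_ofReal_pdx hf, fderiv_ofReal_pdy hf, hs]
  linear_combination fderiv ℝ (fderiv ℝ fun q => (f q : ℂ)) p (0, 1) (0, 1) * Complex.I_sq

lemma ofReal_hessDet (hf : AnalyticAt ℝ f p) :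
    (hessDet f p : ℂ) = 4 * (wirtW (wirtZ fun q => (f q : ℂ)) p ^ 2
      - wirtZ (wirtZ fun q => (f q : ℂ)) p * wirtW (wirtW fun q => (f q : ℂ)) p) := by
  have hs := fderiv_fderiv_comm hf.ofReal_comp
  rw [wirtW, wirtZ, wirtW, fderiv_wirtZ hf.ofReal_comp, fderiv_wirtZ hf.ofReal_comp,
    fderiv_wirtW hf.ofReal_comp, fderiv_wirtW hf.ofReal_comp, hessDet]
  push_cast
  rw [ofReal_pdx hf.pdx, ofReal_pdy hf.pdy, ofReal_pdx hf.pdy, fderiv_ofReal_pdx hf,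
    fderiv_ofReal_pdy hf, fderiv_ofReal_pdy hf, hs]
  generalize fderiv ℝ (fderiv ℝ fun q => (f q : ℂ)) p (1, 0) (1, 0) = x
  generalize fderiv ℝ (fderiv ℝ fun q => (f q : ℂ)) p (0, 1) (1, 0) = y
  generalize fderiv ℝ (fderiv ℝ fun q => (f q : ℂ)) p (0, 1) (0, 1) = z
  linear_combination (x * z - y ^ 2) * Complex.I_sq

lemma wirtinger_jacobian (hf : AnalyticAt ℝ f p) (hJ : jacDet (lap f) (hessDet f) p = 0) :
    (wirtZ (wirtW (wirtZ fun q => (f q : ℂ)))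
      * wirtW (wirtZ (wirtZ fun q => (f q : ℂ)) * wirtW (wirtW fun q => (f q : ℂ)))) p
    = (wirtW (wirtW (wirtZ fun q => (f q : ℂ)))
      * wirtZ (wirtZ (wirtZ fun q => (f q : ℂ)) * wirtW (wirtW fun q => (f q : ℂ)))) p := by
  have hlap : AnalyticAt ℝ (lap f) p := hf.pdx.pdx.add hf.pdy.pdy
  have hdet : AnalyticAt ℝ (hessDet f) p := (hf.pdx.pdx.mul hf.pdy.pdy).sub (hf.pdy.pdx.pow 2)
  set h := wirtW (wirtZ fun q => (f q : ℂ)) with hh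
  set e := wirtZ (wirtZ fun q => (f q : ℂ)) * wirtW (wirtW fun q => (f q : ℂ)) with he
  have hha : HasFDerivAt h (fderiv ℝ h p) p :=
    hf.ofReal_comp.wirtZ.wirtW.differentiableAt.hasFDerivAt
  have hea : HasFDerivAt e (fderiv ℝ e p) p :=
    (hf.ofReal_comp.wirtZ.wirtZ.mul hf.ofReal_comp.wirtW.wirtW).differentiableAt.hasFDerivAt
  have hL : ∀ v, fderiv ℝ (fun q => (lap f q : ℂ)) p v = 4 * fderiv ℝ h p v := by
    intro v
    have h1 : (fun q => (lap f q : ℂ)) =ᶠ[𝓝 p] fun q => 4 * h q :=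
      hf.eventually_analyticAt.mono fun _ hq => ofReal_lap hq
    rw [h1.fderiv_eq, (hha.const_mul 4).fderiv]
    simp
  have hG : ∀ v, fderiv ℝ (fun q => (hessDet f q : ℂ)) p v
      = 4 * (2 * h p * fderiv ℝ h p v - fderiv ℝ e p v) := by
    intro v
    have h1 : (fun q => (hessDet f q : ℂ)) =ᶠ[𝓝 p] fun q => 4 * (h * h - e) q :=
      hf.eventually_analyticAt.mono fun _ hq => by
        simp only [ofReal_hessDet hq, hh, he, Pi.mul_apply, Pi.sub_apply]; ring
    rw [h1.fderiv_eq, (((hha.mul hha).sub hea).const_mul 4).fderiv]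
    simp
    ring
  have hJ' := congrArg (fun r : ℝ => (r : ℂ)) hJ
  simp only [jacDet] at hJ'
  push_cast at hJ'
  rw [ofReal_pdx hlap, ofReal_pdy hlap, ofReal_pdx hdet, ofReal_pdy hdet, hL, hL, hG, hG] at hJ'
  simp only [Pi.mul_apply, wirtZ, wirtW] at hJ' ⊢
  linear_combination (-Complex.I / 32) * hJ'

end RealFunctions

section Assembly

lemma mul_conj_toComplex (p : ℝ × ℝ) :
    toComplex p * conj (toComplex p) = ((p.1 ^ 2 + p.2 ^ 2 : ℝ) : ℂ) := by
  rw [Complex.mul_conj, Complex.normSq_apply, toComplex]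
  push_cast; ring

lemma conj_toComplex_ne_zero {p : ℝ × ℝ} (hp : p ≠ 0) : conj (toComplex p) ≠ 0 := by
  simpa using toComplex_ne_zero hp

lemma eq_zero_of_jet_eq_zero {f : ℝ × ℝ → ℂ} (hf : ∀ p, AnalyticAt ℝ f p)
    (h : ∀ n, jet n f = 0) (p : ℝ × ℝ) : f p = 0 := by
  by_cases hp : p = 0
  · subst hp
    simpa [jet] using h 0
  · have h1 := eqOn_zero_of_iteratedDeriv_eq_zero (h := fun s : ℝ => f (s • p))
      isPreconnected_univ (mem_univ 0) (fun s _ => analyticAt_line (hf _)) fun n => by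
        rw [iteratedDeriv_line n (hf 0) hp, h n]; simp
    simpa using h1 (mem_univ 1)

lemma jet_eq_zero_of_isLittleO {g : ℝ × ℝ → ℝ} {k n : ℕ} (hg : AnalyticAt ℝ g 0)
    (ho : g =o[𝓝 0] fun p => ‖p‖ ^ k) (hn : n ≤ k) : jet n (fun p => (g p : ℂ)) = 0 := by
  refine jet_eq_zero_of_iteratedDeriv_line hg.ofReal_comp fun p _ => ?_
  refine iteratedDeriv_eq_zero_of_isLittleO (k := k)
    (analyticAt_line (by simpa using hg.ofReal_comp)) ?_ hn
  have hc : Filter.Tendsto (fun s : ℝ => s • p) (𝓝 0) (𝓝 0) := by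
    have : Continuous fun s : ℝ => s • p := by fun_prop
    simpa using this.tendsto 0
  have h1 := ho.comp_tendsto hc
  have h2 : (fun s : ℝ => g (s • p)) =o[𝓝 0] fun s : ℝ => s ^ k := by
    refine h1.trans_isBigO (IsBigO.of_bound (‖p‖ ^ k) (Filter.Eventually.of_forall fun s => ?_))
    simp [norm_smul, mul_pow, mul_comm]
  exact IsLittleO.of_norm_left (h2.norm_left.congr_left fun s => by simp)

lemma analyticAt_sq (l : ℝ) (p : ℝ × ℝ) :
    AnalyticAt ℝ (fun p : ℝ × ℝ => l / 2 * (p.1 ^ 2 + p.2 ^ 2)) p :=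
  analyticAt_const.mul ((analyticAt_fst.pow 2).add (analyticAt_snd.pow 2))

lemma ofReal_sq_smul (l s : ℝ) (p : ℝ × ℝ) :
    ((l / 2 * ((s • p).1 ^ 2 + (s • p).2 ^ 2) : ℝ) : ℂ)
      = s ^ 2 • ((l / 2 * (p.1 ^ 2 + p.2 ^ 2) : ℝ) : ℂ) := by
  simp; ring

lemma jet_two_sq (l : ℝ) :
    jet 2 (fun p : ℝ × ℝ => ((l / 2 * (p.1 ^ 2 + p.2 ^ 2) : ℝ) : ℂ))
      = Polynomial.C (l / 2 : ℂ) * Polynomial.X := by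
  rw [← sub_eq_zero]
  refine eq_zero_of_forall_eval_eq_zero fun p hp => ?_
  have h := eval_jet_of_homogeneous (k := 2) (analyticAt_sq l 0).ofReal_comp (ofReal_sq_smul l) hp
  have hz := conj_toComplex_ne_zero hp
  rw [Complex.ofReal_mul, ← mul_conj_toComplex] at h
  rw [Polynomial.eval_sub, sub_eq_zero]
  apply mul_left_cancel₀ (pow_ne_zero 2 hz)
  rw [← h]
  simp
  field_simp

lemma exists_eq_C_mul_X_pow_of_radialDefect_eq_zero {P : Polynomial ℂ} {n : ℕ}
    (h : radialDefect n P = 0) : P = 0 ∨ ∃ m b, n = 2 * m ∧ P = Polynomial.C b * Polynomial.X ^ m := by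
  have hi : ∀ i, P.coeff i ≠ 0 → n = 2 * i := by
    intro i hi
    have e := congrArg (Polynomial.coeff · i) h
    rw [radialDefect, show (2 : Polynomial ℂ) = ((2 : ℕ) : Polynomial ℂ) by norm_num] at e
    simp only [Int.cast_natCast, Polynomial.coeff_sub, coeff_natCast_mul', coeff_X_mul_derivative,
      Polynomial.coeff_zero] at e
    have : (n : ℂ) = ((2 * i : ℕ) : ℂ) := by
      apply mul_right_cancel₀ hi
      push_cast at e ⊢
      linear_combination -e
    exact_mod_cast this
  by_cases hP : P = 0
  · exact Or.inl hP
  · right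
    refine ⟨P.natDegree, P.leadingCoeff, hi _ (by simpa using hP), ?_⟩
    ext i
    rw [Polynomial.coeff_C_mul_X_pow]
    split_ifs with hid
    · rw [hid, Polynomial.leadingCoeff]
    · by_contra hne
      have h1 := hi i hne
      have h2 := hi P.natDegree (by simpa using hP)
      omega

/-- A function all of whose jets are radial is radial. -/
lemma eq_of_radialDefect_jet_eq_zero {U : ℝ × ℝ → ℂ} {R : ℝ}
    (hU : AnalyticOnNhd ℝ U {p : ℝ × ℝ | p.1 ^ 2 + p.2 ^ 2 < R ^ 2})
    (hrad : ∀ n : ℕ, radialDefect n (jet n U) = 0) {p q : ℝ × ℝ} (hp : p.1 ^ 2 + p.2 ^ 2 < R ^ 2)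
    (hpq : p.1 ^ 2 + p.2 ^ 2 = q.1 ^ 2 + q.2 ^ 2) (hp0 : p ≠ 0) (hq0 : q ≠ 0) : U p = U q := by
  have hR : 0 < R ^ 2 := lt_of_le_of_lt (by positivity) hp
  have h0 : AnalyticAt ℝ U 0 := hU 0 (by simpa using hR)
  have hline : ∀ {x : ℝ × ℝ}, x ≠ 0 → ∀ n, iteratedDeriv n (fun s : ℝ => U (s • x)) 0
      = n.factorial * (conj (toComplex x) ^ n
        * (jet n U).eval (toComplex x / conj (toComplex x))) := fun hx n => by
    rw [iteratedDeriv_line n h0 hx, mul_assoc]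
  have hval : ∀ n, conj (toComplex p) ^ n * (jet n U).eval (toComplex p / conj (toComplex p))
      = conj (toComplex q) ^ n * (jet n U).eval (toComplex q / conj (toComplex q)) := by
    intro n
    rcases exists_eq_C_mul_X_pow_of_radialDefect_eq_zero (hrad n) with h | ⟨m, b, rfl, h⟩
    · simp [h]
    · have key : ∀ {x : ℝ × ℝ}, x ≠ 0 → conj (toComplex x) ^ (2 * m)
          * (jet (2 * m) U).eval (toComplex x / conj (toComplex x))
          = b * ((x.1 ^ 2 + x.2 ^ 2 : ℝ) : ℂ) ^ m := by
        intro x hx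
        have hz := conj_toComplex_ne_zero hx
        rw [h, ← mul_conj_toComplex]
        simp only [Polynomial.eval_mul, Polynomial.eval_C, Polynomial.eval_pow, Polynomial.eval_X,
          div_pow, mul_pow]
        field_simp
        ring
      rw [key hp0, key hq0, hpq]
  set S : Set ℝ := {s | s ^ 2 * (p.1 ^ 2 + p.2 ^ 2) < R ^ 2} with hS
  have hconv : IsPreconnected S := by
    apply Set.OrdConnected.isPreconnected
    refine ⟨fun a ha b hb s hs => ?_⟩
    simp only [hS, mem_ofPred_eq] at ha hb ⊢
    have hs2 : s ^ 2 ≤ max (a ^ 2) (b ^ 2) := by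
      rcases le_total 0 s with h | h
      · exact le_max_of_le_right (by nlinarith [hs.2])
      · exact le_max_of_le_left (by nlinarith [hs.1])
    rcases le_max_iff.1 hs2 with h | h
    · exact (mul_le_mul_of_nonneg_right h (by positivity)).trans_lt ha
    · exact (mul_le_mul_of_nonneg_right h (by positivity)).trans_lt hb
  have hmem : ∀ s ∈ S, AnalyticAt ℝ U (s • p) ∧ AnalyticAt ℝ U (s • q) := by
    intro s hs
    simp only [hS, mem_ofPred_eq] at hs
    refine ⟨hU _ ?_, hU _ ?_⟩
    · simp only [mem_ofPred_eq, Prod.smul_fst, Prod.smul_snd, smul_eq_mul]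
      linarith
    · simp only [mem_ofPred_eq, Prod.smul_fst, Prod.smul_snd, smul_eq_mul]
      rw [hpq] at hs
      linarith
  have hS0 : (0 : ℝ) ∈ S := by simpa [hS] using hR
  have hS1 : (1 : ℝ) ∈ S := by simpa [hS] using hp
  have hfin := eqOn_zero_of_iteratedDeriv_eq_zero
    (h := (fun s : ℝ => U (s • p)) - fun s : ℝ => U (s • q)) hconv hS0
    (fun s hs => (analyticAt_line (hmem s hs).1).sub (analyticAt_line (hmem s hs).2)) (fun n => by
      rw [iteratedDeriv_sub (analyticAt_line (hmem 0 hS0).1).contDiffAt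
        (analyticAt_line (hmem 0 hS0).2).contDiffAt, hline hp0, hline hq0, hval, sub_self])
  have := hfin hS1
  simpa [sub_eq_zero] using this

section Polynomial

variable {k : ℕ} {w : MvPolynomial (Fin 2) ℝ}

lemma analyticAt_eval_mvPolynomial (w : MvPolynomial (Fin 2) ℝ) (p : ℝ × ℝ) :
    AnalyticAt ℝ (fun q : ℝ × ℝ => MvPolynomial.eval ![q.1, q.2] w) p := by
  have h := AnalyticAt.aeval_mvPolynomial (𝕜 := ℝ) (z := p) (B := ℝ)
    (f := fun q : ℝ × ℝ => ![q.1, q.2]) (fun i => by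
      fin_cases i
      · exact analyticAt_fst
      · exact analyticAt_snd) w
  simpa [MvPolynomial.aeval_eq_eval] using h

lemma ofReal_eval_smul (hw : w.IsHomogeneous k) (s : ℝ) (p : ℝ × ℝ) :
    ((MvPolynomial.eval ![(s • p).1, (s • p).2] w : ℝ) : ℂ)
      = s ^ k • ((MvPolynomial.eval ![p.1, p.2] w : ℝ) : ℂ) := by
  have h : MvPolynomial.eval ![(s • p).1, (s • p).2] w
      = s ^ k * MvPolynomial.eval ![p.1, p.2] w := by
    rw [MvPolynomial.eval_eq', MvPolynomial.eval_eq', Finset.mul_sum]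
    refine Finset.sum_congr rfl fun d hd => ?_
    have hdeg := hw (MvPolynomial.mem_support_iff.1 hd)
    rw [Finsupp.weight_apply, Finsupp.sum_fintype _ _ (by simp)] at hdeg
    simp only [Fin.sum_univ_two, Pi.one_apply, smul_eq_mul, mul_one] at hdeg
    simp only [Fin.prod_univ_two, ← hdeg]
    simp
    ring
  rw [h]; simp

lemma lap_eq_zero_of_opZW_jet_eq_zero (hw : w.IsHomogeneous k)
    (h : opZW k (jet k fun q => ((MvPolynomial.eval ![q.1, q.2] w : ℝ) : ℂ)) = 0) (p : ℝ × ℝ) :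
    lap (fun q : ℝ × ℝ => MvPolynomial.eval ![q.1, q.2] w) p = 0 := by
  have ha := analyticAt_eval_mvPolynomial w
  have h1 := eq_zero_of_jet_eq_zero (fun p => (ha p).ofReal_comp.wirtZ.wirtW) (fun n => by
    rw [jet_wirtW_wirtZ (ha 0).ofReal_comp]
    by_cases hn : n + 2 = k
    · rw [hn, h]
    · rw [jet_of_homogeneous (ha 0).ofReal_comp (ofReal_eval_smul hw) hn]
      simp [opZW]) p
  have h2 := ofReal_lap (ha p)
  rw [h1, mul_zero] at h2
  exact_mod_cast h2

/-- A form whose dehomogenization is a power of a linear polynomial with root on the unit circle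
is a power of a real linear form. -/
lemma exists_eq_pow_linear (hk : k ≠ 0) (hw : w.IsHomogeneous k) {a t : ℂ} (ht : ‖t‖ = 1)
    (h : jet k (fun q => ((MvPolynomial.eval ![q.1, q.2] w : ℝ) : ℂ))
      = Polynomial.C a * (Polynomial.X - Polynomial.C t) ^ k) :
    ∃ a α β : ℝ, (α, β) ≠ ((0 : ℝ), (0 : ℝ)) ∧
      w = MvPolynomial.C a * (MvPolynomial.C α * MvPolynomial.X 0 +
        MvPolynomial.C β * MvPolynomial.X 1) ^ k := by
  obtain ⟨η, hη⟩ := IsAlgClosed.exists_pow_nat_eq (-t) (n := 2) (by norm_num)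
  have hη1 : ‖η‖ = 1 := by
    have : ‖η‖ ^ 2 = 1 := by rw [← norm_pow, hη, norm_neg, ht]
    exact (pow_eq_one_iff_of_nonneg (norm_nonneg η) two_ne_zero).1 this
  have hηc : η * conj η = 1 := by
    rw [Complex.mul_conj, Complex.normSq_eq_norm_sq, hη1]; simp
  have hab : η.re ^ 2 + η.im ^ 2 = 1 := by
    have := congrArg Complex.re hηc
    simp at this
    linarith
  have hne : (η.re, η.im) ≠ ((0 : ℝ), (0 : ℝ)) := by
    intro h0
    rw [Prod.mk.injEq] at h0
    rw [h0.1, h0.2] at hab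
    norm_num at hab
  have ha := (analyticAt_eval_mvPolynomial w 0).ofReal_comp
  have hval : ∀ p : ℝ × ℝ, ((MvPolynomial.eval ![p.1, p.2] w : ℝ) : ℂ)
      = a * (2 * η) ^ k * ((η.re * p.1 + η.im * p.2 : ℝ) : ℂ) ^ k := by
    intro p
    by_cases hp : p = 0
    · have h0 := ofReal_eval_smul hw 0 0
      subst hp
      simpa [hk] using h0
    · have hz := conj_toComplex_ne_zero hp
      rw [eval_jet_of_homogeneous ha (ofReal_eval_smul hw) hp, h]
      have hlin : toComplex p - t * conj (toComplex p)
          = 2 * η * ((η.re * p.1 + η.im * p.2 : ℝ) : ℂ) := by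
        have h2 : ((η.re * p.1 + η.im * p.2 : ℝ) : ℂ) * 2
            = conj η * toComplex p + η * conj (toComplex p) := by
          apply Complex.ext <;> simp [toComplex] <;> ring
        linear_combination -η * h2 - toComplex p * hηc - conj (toComplex p) * hη
      rw [mul_assoc, ← mul_pow, ← hlin]
      simp only [Polynomial.eval_mul, Polynomial.eval_C, Polynomial.eval_pow, Polynomial.eval_sub,
        Polynomial.eval_X]
      rw [mul_left_comm, ← mul_pow]
      congr 2
      field_simp
  set b : ℝ := MvPolynomial.eval ![η.re, η.im] w with hb
  have hbv : (b : ℂ) = a * (2 * η) ^ k := by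
    have h1 := hval (η.re, η.im)
    rw [show η.re * (η.re, η.im).1 + η.im * (η.re, η.im).2 = 1 by simp only; linarith] at h1
    simpa using h1
  refine ⟨b, η.re, η.im, hne, MvPolynomial.funext fun x => ?_⟩
  have h1 := hval (x 0, x 1)
  rw [← hbv, show ![(x 0, x 1).1, (x 0, x 1).2] = x by ext i; fin_cases i <;> rfl] at h1
  have h2 : MvPolynomial.eval x w = b * (η.re * x 0 + η.im * x 1) ^ k := by exact_mod_cast h1
  simpa using h2

end Polynomial

end Assembly

/-- **Corollary.** Let `u` be real analytic on a ball `B` centered at the origin with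
`J[Δu, det D²u] ≡ 0` on `B`.  If near the origin
`u(x,y) = (λ/2)(x²+y²) + w(x,y) + o(ρ^k)`, where `w` is a homogeneous polynomial of degree
`k ≥ 3` that is neither harmonic nor a power `a(αx+βy)^k` of a linear function, then `u` is
radial with respect to the origin. -/
theorem radial_symmetry_corollary
    (R : ℝ) (hR : 0 < R)
    (u : ℝ × ℝ → ℝ)
    (hu : AnalyticOnNhd ℝ u {p : ℝ × ℝ | p.1 ^ 2 + p.2 ^ 2 < R ^ 2})
    (hJ : ∀ p : ℝ × ℝ, p.1 ^ 2 + p.2 ^ 2 < R ^ 2 → jacDet (lap u) (hessDet u) p = 0)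
    (l : ℝ) (k : ℕ) (hk : 3 ≤ k)
    (w : MvPolynomial (Fin 2) ℝ) (hwhom : w.IsHomogeneous k)
    -- `w` is not harmonic
    (hwharm : ¬∀ p : ℝ × ℝ,
      lap (fun q : ℝ × ℝ => MvPolynomial.eval ![q.1, q.2] w) p = 0)
    -- `w` is not a power of a linear function
    (hwlin : ¬∃ a α β : ℝ, (α, β) ≠ ((0 : ℝ), (0 : ℝ)) ∧
      w = MvPolynomial.C a * (MvPolynomial.C α * MvPolynomial.X 0 +
        MvPolynomial.C β * MvPolynomial.X 1) ^ k)
    -- near the origin, `u = (λ/2)(x²+y²) + w + o(ρ^k)`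
    (ho : (fun p : ℝ × ℝ =>
        u p - (l / 2 * (p.1 ^ 2 + p.2 ^ 2) + MvPolynomial.eval ![p.1, p.2] w))
      =o[𝓝 ((0, 0) : ℝ × ℝ)] fun p => ‖p‖ ^ k) :
    ∀ q₁ : ℝ × ℝ, q₁.1 ^ 2 + q₁.2 ^ 2 < R ^ 2 →
      ∀ q₂ : ℝ × ℝ, q₂.1 ^ 2 + q₂.2 ^ 2 < R ^ 2 →
        q₁.1 ^ 2 + q₁.2 ^ 2 = q₂.1 ^ 2 + q₂.2 ^ 2 → u q₁ = u q₂ := by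
  intro q₁ hq₁ q₂ _ hq
  have hR2 : 0 < R ^ 2 := by positivity
  have hu0 : AnalyticAt ℝ u 0 := hu 0 (by simpa using hR2)
  have hw0 := analyticAt_eval_mvPolynomial w 0
  have hs0 := analyticAt_sq l 0
  set U : ℝ × ℝ → ℂ := fun p => (u p : ℂ) with hUdef
  have hU0 : AnalyticAt ℝ U 0 := hu0.ofReal_comp
  have hjets : ∀ n ≤ k, jet n U
      = jet n (fun p : ℝ × ℝ => ((l / 2 * (p.1 ^ 2 + p.2 ^ 2) : ℝ) : ℂ))
        + jet n (fun p : ℝ × ℝ => ((MvPolynomial.eval ![p.1, p.2] w : ℝ) : ℂ)) := by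
    intro n hn
    have hg0 : AnalyticAt ℝ (fun p : ℝ × ℝ =>
        u p - (l / 2 * (p.1 ^ 2 + p.2 ^ 2) + MvPolynomial.eval ![p.1, p.2] w)) 0 :=
      hu0.sub (hs0.add hw0)
    have h1 := jet_eq_zero_of_isLittleO hg0 ho hn
    have h2 := jet_add n (hs0.ofReal_comp.add hw0.ofReal_comp) hg0.ofReal_comp
    rw [jet_add n hs0.ofReal_comp hw0.ofReal_comp, h1, add_zero] at h2
    rw [← h2]
    congr 1
    funext p
    simp [hUdef]
  have hwjet : ∀ n, n ≠ k →
      jet n (fun p : ℝ × ℝ => ((MvPolynomial.eval ![p.1, p.2] w : ℝ) : ℂ)) = 0 := fun n hn =>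
    jet_of_homogeneous hw0.ofReal_comp (ofReal_eval_smul hwhom) hn
  have hsjet : ∀ n, n ≠ 2 →
      jet n (fun p : ℝ × ℝ => ((l / 2 * (p.1 ^ 2 + p.2 ^ 2) : ℝ) : ℂ)) = 0 := fun n hn =>
    jet_of_homogeneous hs0.ofReal_comp (ofReal_sq_smul l) hn
  have hUk : jet k U = jet k (fun p : ℝ × ℝ => ((MvPolynomial.eval ![p.1, p.2] w : ℝ) : ℂ)) := by
    rw [hjets k le_rfl, hsjet k (by omega), zero_add]
  have hU2 : jet 2 U = Polynomial.C (l / 2 : ℂ) * Polynomial.X := by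
    rw [hjets 2 (by omega), hwjet 2 (by omega), add_zero, jet_two_sq]
  have hUlt : ∀ n < k, n ≠ 2 → jet n U = 0 := fun n hn hn2 => by
    rw [hjets n hn.le, hwjet n hn.ne, hsjet n hn2, add_zero]
  have hformal : FormalJacobianEqZero fun n => jet n U := by
    refine formalJacobianEqZero_jet hU0 ?_
    have hball : ∀ᶠ p : ℝ × ℝ in 𝓝 0, p.1 ^ 2 + p.2 ^ 2 < R ^ 2 :=
      ContinuousAt.eventually_lt (by fun_prop) (by fun_prop) (by simpa using hR2)
    filter_upwards [hball] with p hp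
    exact wirtinger_jacobian (hu p hp) (hJ p hp)
  have hH : opZW k (jet k U) ≠ 0 := fun h =>
    hwharm (lap_eq_zero_of_opZW_jet_eq_zero hwhom (hUk ▸ h))
  have hsym : ∀ i j, i + j = k → (jet k U).coeff i = conj ((jet k U).coeff j) := by
    intro i j hij
    rw [← coeff_jet_conj k hU0 i j hij]
    simp [hUdef]
  have hrad : ∀ n : ℕ, radialDefect n (jet n U) = 0 := by
    obtain ⟨K, rfl⟩ : ∃ K, k = K + 2 := ⟨k - 2, by omega⟩
    obtain ⟨c, hc⟩ := exists_leading_equation (by omega) hformal hU2 hUlt hH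
    rcases eq_C_mul_pow_or_eq_C_mul_X_pow hk (natDegree_jet_le _ U) hsym hH hc with
      ⟨a, t, ht, hf⟩ | ⟨m, a, ha, hm, hf⟩
    · exact absurd (exists_eq_pow_linear (by omega) hwhom ht (hUk ▸ hf)) hwlin
    · rw [hm] at hf
      exact radialDefect_eq_zero (by omega) ha hformal hU2 (hm ▸ hUlt) hf
  by_cases h1 : q₁ = 0 ∨ q₂ = 0
  · have hzero : ∀ q : ℝ × ℝ, q.1 ^ 2 + q.2 ^ 2 = 0 → q = 0 := fun q h =>
      Prod.ext (by simp; nlinarith [sq_nonneg q.1, sq_nonneg q.2])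
        (by simp; nlinarith [sq_nonneg q.1, sq_nonneg q.2])
    rcases h1 with rfl | rfl
    · rw [hzero q₂ (by simpa using hq.symm)]
    · rw [hzero q₁ (by simpa using hq)]
  · push Not at h1
    have hUan : AnalyticOnNhd ℝ U {p : ℝ × ℝ | p.1 ^ 2 + p.2 ^ 2 < R ^ 2} := fun p hp =>
      (hu p hp).ofReal_comp
    exact Complex.ofReal_injective
      (eq_of_radialDefect_jet_eq_zero hUan hrad hq₁ hq h1.1 h1.2)
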